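/- arXiv:1310.1310 — 8 statements merged into one kernel-verified Lean document; each statement's English description precedes it below -/
import Mathlib

section
/- Let λ > 0, let c : ℝ → ℝ be continuous with 0 ≤ c(s) ≤ λ for all s, let a₀, a₁, b₀, k ∈ ℝ with a₁ ≠ 0, and define α(t) = a₁ t + a₀ and β(t) = b₀ + (a₁/2) ∫₀ᵗ c(α(s)) ds for t ∈ ℝ. Then there exists t* ∈ ℝ such that β(t*) = λ α(t*) - k. -/
/-- A null geodesic `γ = (α, β)` of the 2D NPW metric `2 du dv - c(u) du²` with
`α(t) = a₁t + a₀`, `a₁ ≠ 0`, and `β(t) = b₀ + (a₁/2)∫₀ᵗ c(α(s)) ds`, where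
`0 ≤ c ≤ λ`, meets the hypersurface `S^k_λ = {(u, λu - k)}`: there is `t*` with
`β(t*) = λ α(t*) - k`. -/
theorem stmt4 (lam : ℝ) (hlam : 0 < lam) (c : ℝ → ℝ) (hc : Continuous c)
    (hc0 : ∀ s, 0 ≤ c s) (hc1 : ∀ s, c s ≤ lam)
    (a₀ a₁ b₀ k : ℝ) (ha₁ : a₁ ≠ 0)
    (α β : ℝ → ℝ) (hα : ∀ t, α t = a₁ * t + a₀)
    (hβ : ∀ t, β t = b₀ + (a₁ / 2) * ∫ s in (0 : ℝ)..t, c (α s)) :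
    ∃ t, β t = lam * α t - k := by
  have hcα : Continuous fun s => c (α s) := by
    rw [show α = fun t => a₁ * t + a₀ from funext hα]
    fun_prop
  have hint : ∀ x, |(a₁ / 2) * ∫ s in (0 : ℝ)..(x / a₁), c (α s)| ≤ lam * |x| / 2 := by
    intro x
    have hI : ‖∫ s in (0 : ℝ)..(x / a₁), c (α s)‖ ≤ lam * |x / a₁ - 0| :=
      intervalIntegral.norm_integral_le_of_norm_le_const fun s _ => by
        rw [Real.norm_eq_abs, abs_of_nonneg (hc0 _)]
        exact hc1 _
    rw [Real.norm_eq_abs, sub_zero, abs_div] at hI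
    have ha : 0 < |a₁| := abs_pos.mpr ha₁
    calc |(a₁ / 2) * ∫ s in (0 : ℝ)..(x / a₁), c (α s)|
        = |a₁| / 2 * |∫ s in (0 : ℝ)..(x / a₁), c (α s)| := by
          rw [abs_mul, abs_div, abs_two]
      _ ≤ |a₁| / 2 * (lam * (|x| / |a₁|)) := by gcongr
      _ = lam * |x| / 2 := by field_simp
  have hcont : Continuous fun t => lam * α t - k - β t := by
    have hI : Continuous fun t => ∫ s in (0 : ℝ)..t, c (α s) :=
      intervalIntegral.continuous_primitive (fun a b => hcα.intervalIntegrable a b) 0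
    simp only [hβ, hα] at hI ⊢
    fun_prop
  have hval : ∀ x, lam * α (x / a₁) - k - β (x / a₁) =
      lam * x + (lam * a₀ - k - b₀) - (a₁ / 2) * ∫ s in (0 : ℝ)..(x / a₁), c (α s) := by
    intro x
    rw [hβ, hα (x / a₁), mul_div_cancel₀ x ha₁]
    ring
  set D := lam * a₀ - k - b₀
  set M := 2 * |D| / lam with hM
  have hM0 : 0 ≤ M := by positivity
  have hMD : lam * M = 2 * |D| := by rw [hM]; field_simp
  have hD := abs_le.mp (le_refl |D|)
  obtain ⟨t, ht⟩ := mem_range_of_exists_le_of_exists_ge (c := (0 : ℝ)) hcont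
    ⟨-M / a₁, by
      have h := abs_le.mp (hint (-M))
      rw [abs_neg, abs_of_nonneg hM0] at h
      rw [hval]
      linarith [h.1]⟩
    ⟨M / a₁, by
      have h := abs_le.mp (hint M)
      rw [abs_of_nonneg hM0] at h
      rw [hval]
      linarith [h.2]⟩
  exact ⟨t, (sub_eq_zero.mp ht).symm⟩
end

section
/- Let λ > 0, let f, q : ℝ → ℝ be continuous with 0 ≤ f(s) ≤ λ and q(s) ≥ 0 for all s, let a₀, a₁, b₀, k ∈ ℝ with a₁ ≠ 0, and define α(t) = a₁ t + a₀ and β(t) = b₀ + (a₁/2) ∫₀ᵗ f(s) ds - (1/(2a₁)) ∫₀ᵗ q(s) ds for t ∈ ℝ. Then there exists t* ∈ ℝ such that β(t*) = λ α(t*) - k. -/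
open Filter in
/-- A primitive of a continuous function bounded below by a positive constant is onto. -/
theorem surjective_intervalIntegral_of_le {p : ℝ → ℝ} (hp : Continuous p) {m : ℝ}
    (hm : 0 < m) (hmp : ∀ s, m ≤ p s) :
    Function.Surjective fun t => ∫ s in (0 : ℝ)..t, p s := by
  have key : ∀ a b : ℝ, a ≤ b → m * (b - a) ≤ ∫ s in a..b, p s := fun a b hab => by
    have h := intervalIntegral.integral_mono_on (μ := MeasureTheory.volume) hab
      (continuous_const (y := m) |>.intervalIntegrable a b) (hp.intervalIntegrable a b)
      fun s _ => hmp s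
    rw [intervalIntegral.integral_const, smul_eq_mul] at h
    linarith
  refine Continuous.surjective
    (intervalIntegral.continuous_primitive (fun a b => hp.intervalIntegrable a b) 0) ?_ ?_
  · refine tendsto_atTop_mono' _ ?_ (tendsto_id.const_mul_atTop hm)
    filter_upwards [eventually_ge_atTop 0] with t ht
    simpa using key 0 t ht
  · refine tendsto_atBot_mono' _ ?_ (tendsto_id.const_mul_atBot hm)
    filter_upwards [eventually_le_atBot 0] with t ht
    have h := key t 0 ht
    rw [intervalIntegral.integral_symm] at h
    simp only [id]
    linarith


/-- A null geodesic `γ = (ξ, α, β)` of the NPW metric with `α(t) = a₁t + a₀`, `a₁ ≠ 0`,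
and `β(t) = b₀ + (a₁/2)∫₀ᵗ f(s) ds - (1/(2a₁))∫₀ᵗ q(s) ds`, where `0 ≤ f ≤ λ` abstracts
`a(ξ,α)` and `q ≥ 0` abstracts `h(ξ̇,ξ̇)`, meets the hypersurface `S^k_λ`: there is `t*`
with `β(t*) = λ α(t*) - k`. -/
theorem stmt5 (lam : ℝ) (hlam : 0 < lam) (f q : ℝ → ℝ)
    (hf : Continuous f) (hq : Continuous q)
    (hf0 : ∀ s, 0 ≤ f s) (hf1 : ∀ s, f s ≤ lam) (hq0 : ∀ s, 0 ≤ q s)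
    (a₀ a₁ b₀ k : ℝ) (ha₁ : a₁ ≠ 0)
    (α β : ℝ → ℝ) (hα : ∀ t, α t = a₁ * t + a₀)
    (hβ : ∀ t, β t = b₀ + (a₁ / 2) * (∫ s in (0 : ℝ)..t, f s)
      - (1 / (2 * a₁)) * ∫ s in (0 : ℝ)..t, q s) :
    ∃ t, β t = lam * α t - k := by
  obtain ⟨t, ht⟩ := surjective_intervalIntegral_of_le
    (p := fun s => a₁ ^ 2 * lam - a₁ ^ 2 / 2 * f s + 1 / 2 * q s) (by fun_prop)
    (m := a₁ ^ 2 * lam / 2) (by positivity)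
    (fun s => by nlinarith [mul_le_mul_of_nonneg_left (hf1 s) (sq_nonneg a₁), hq0 s])
    (a₁ * (b₀ + k - lam * a₀))
  have hfi : IntervalIntegrable (fun s => a₁ ^ 2 / 2 * f s) MeasureTheory.volume 0 t :=
    (hf.const_mul _).intervalIntegrable 0 t
  have hqi : IntervalIntegrable (fun s => 1 / 2 * q s) MeasureTheory.volume 0 t :=
    (hq.const_mul _).intervalIntegrable 0 t
  have hc : IntervalIntegrable (fun _ : ℝ => a₁ ^ 2 * lam) MeasureTheory.volume 0 t :=
    continuous_const.intervalIntegrable 0 t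
  beta_reduce at ht
  rw [intervalIntegral.integral_add (hc.sub hfi) hqi, intervalIntegral.integral_sub hc hfi,
    intervalIntegral.integral_const, intervalIntegral.integral_const_mul,
    intervalIntegral.integral_const_mul, smul_eq_mul] at ht
  refine ⟨t, ?_⟩
  rw [hα, hβ]
  field_simp
  linarith
end

section
/- Let λ > 0 and let a : ℝ → ℝ be continuous with 0 ≤ a(s) ≤ λ for all s. Define F(u) = ∫₀ᵘ (2λ - a(s)) ds (a bijection of ℝ) and K(t,u) = F⁻¹(t + F(u)). Fix (u,v) ∈ ℝ². Then the functions α(t) := K(t,u) and β(t) := v - λu - t + λ K(t,u) satisfy α(0) = u, β(0) = v, and for every t ∈ ℝ, α is differentiable at t with α'(t) = 1/(2λ - a(α(t))) and β is differentiable at t with β'(t) = (a(α(t)) - λ)/(2λ - a(α(t))). -/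
open Filter Topology

/-- A real function whose derivative is bounded below by a positive constant is bijective. -/
theorem bijective_of_hasDerivAt_ge {F f : ℝ → ℝ} {c : ℝ} (hc : 0 < c)
    (hF : ∀ x, HasDerivAt F (f x) x) (hf : ∀ x, c ≤ f x) : Function.Bijective F := by
  have hcont : Continuous F :=
    continuous_iff_continuousAt.2 fun x => (hF x).continuousAt
  have hmono : Monotone fun x => F x - c * x := by
    have hd : ∀ x, HasDerivAt (fun x => F x - c * x) (f x - c) x := fun x => by
      simpa using (hF x).fun_sub ((hasDerivAt_id x).const_mul c)
    refine monotone_of_deriv_nonneg (fun x => (hd x).differentiableAt) fun x => ?_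
    rw [(hd x).deriv]
    exact sub_nonneg.2 (hf x)
  have hstrict : StrictMono F :=
    strictMono_of_deriv_pos fun x => by
      rw [(hF x).deriv]
      exact hc.trans_le (hf x)
  refine ⟨hstrict.injective, hcont.surjective ?_ ?_⟩
  · refine tendsto_atTop_mono' atTop (f₁ := fun x => c * x + F 0) ?_
      (tendsto_atTop_add_const_right _ _ (tendsto_id.const_mul_atTop hc))
    filter_upwards [eventually_ge_atTop 0] with x hx
    have := hmono hx
    simp only at this
    linarith
  · refine tendsto_atBot_mono' atBot (f₁ := fun x => c * x + F 0) ?_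
      (tendsto_atBot_add_const_right _ _ (tendsto_id.const_mul_atBot hc))
    filter_upwards [eventually_le_atBot 0] with x hx
    have := hmono hx
    simp only at this
    linarith

/-- The inverse of a real function with derivative bounded below by a positive constant is
differentiable, with the reciprocal derivative. -/
theorem hasDerivAt_invFun_of_hasDerivAt_ge {F f : ℝ → ℝ} {c : ℝ} (hc : 0 < c)
    (hF : ∀ x, HasDerivAt F (f x) x) (hf : ∀ x, c ≤ f x) (y : ℝ) :
    HasDerivAt (Function.invFun F) (f (Function.invFun F y))⁻¹ y := by
  have hbij := bijective_of_hasDerivAt_ge hc hF hf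
  have hstrict : StrictMono F :=
    strictMono_of_deriv_pos fun x => by
      rw [(hF x).deriv]
      exact hc.trans_le (hf x)
  have hright : Function.RightInverse (Function.invFun F) F :=
    Function.rightInverse_invFun hbij.surjective
  have hcont : Continuous (Function.invFun F) := by
    refine Monotone.continuous_of_surjective (fun x y hxy => ?_)
      (Function.invFun_surjective hbij.injective)
    rwa [← hstrict.le_iff_le, hright, hright]
  exact (hF _).of_local_left_inverse hcont.continuousAt (hc.trans_le (hf _)).ne'
    (Eventually.of_forall hright)


/-- The explicit flow of the normalized gradient of `τ_λ`: with
`F(u) = ∫₀ᵘ (2λ - a(s)) ds` and `K(t,u) = F⁻¹(t + F(u))`, the curves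
`α(t) = K(t,u)` and `β(t) = v - λu - t + λK(t,u)` start at `(u,v)` and solve
`α' = 1/(2λ - a(α))`, `β' = (a(α) - λ)/(2λ - a(α))`. -/
theorem stmt7 (lam : ℝ) (hlam : 0 < lam) (a : ℝ → ℝ) (ha : Continuous a)
    (ha0 : ∀ s, 0 ≤ a s) (ha1 : ∀ s, a s ≤ lam)
    (F : ℝ → ℝ) (hF : ∀ z, F z = ∫ s in (0 : ℝ)..z, (2 * lam - a s))
    (K : ℝ → ℝ → ℝ) (hK : ∀ t u, K t u = Function.invFun F (t + F u))
    (u v : ℝ) (α β : ℝ → ℝ)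
    (hα : ∀ t, α t = K t u) (hβ : ∀ t, β t = v - lam * u - t + lam * K t u) :
    α 0 = u ∧ β 0 = v ∧
    ∀ t, HasDerivAt α (1 / (2 * lam - a (α t))) t ∧
      HasDerivAt β ((a (α t) - lam) / (2 * lam - a (α t))) t := by
  have hpos : ∀ x, lam ≤ 2 * lam - a x := fun x => by linarith [ha1 x]
  have hFd : ∀ x, HasDerivAt F (2 * lam - a x) x := fun x => by
    rw [funext hF]
    exact (continuous_const.sub ha).integral_hasStrictDerivAt 0 x |>.hasDerivAt
  have hK0 : K 0 u = u := by
    rw [hK, zero_add]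
    exact Function.leftInverse_invFun (bijective_of_hasDerivAt_ge hlam hFd hpos).injective u
  have hαd : ∀ t, HasDerivAt α (1 / (2 * lam - a (α t))) t := fun t => by
    have hα' : α = fun t => Function.invFun F (t + F u) := funext fun t => by rw [hα, hK]
    rw [hα', one_div]
    exact (hasDerivAt_invFun_of_hasDerivAt_ge hlam hFd hpos (t + F u)).comp_add_const t (F u)
  refine ⟨by rw [hα, hK0], by rw [hβ, hK0]; ring, fun t => ⟨hαd t, ?_⟩⟩
  have hβ' : β = fun t => v - lam * u - t + lam * α t := funext fun t => by rw [hβ, hα]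
  have hne : 2 * lam - a (α t) ≠ 0 := (hlam.trans_le (hpos _)).ne'
  rw [hβ']
  refine (((hasDerivAt_id t).const_sub (v - lam * u)).add ((hαd t).const_mul lam)).congr_deriv ?_
  rw [eq_div_iff hne, add_mul, mul_assoc, one_div_mul_cancel hne]
  ring
end

section
/- Let n ∈ ℕ, let h be a symmetric real n×n matrix, let λ > 0, let a, A ∈ ℝ with 0 ≤ a ≤ λ and 0 ≤ A ≤ λ, and let p ∈ ℝⁿ. Order coordinates as (x¹,…,xⁿ,t,u) in the domain and (x¹,…,xⁿ,u,v) in the target, and set L = [[h,0,0],[0,-A,1],[0,1,0]] ((n+2)×(n+2), blocks of sizes n,1,1) and J = [[Iₙ,0,0],[pᵀ, 1/(2λ-A), (2λ-a)/(2λ-A)],[λpᵀ, -1 + λ/(2λ-A), λ(2λ-a)/(2λ-A)]]. Then Jᵀ L J = [[h + (2λ-A) p pᵀ, 0, (2λ-a) p],[0, -1/(2λ-A), 0],[(2λ-a) pᵀ, 0, (2λ-a)²/(2λ-A)]]. -/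
open Matrix

/-- The pull-back of the NPW metric `L` under the Jacobian `J` of the splitting
diffeomorphism `Φ(t,x,u) = (x, K_x(t,u), -t + λK_x(t,u))` (with `p = ∇ₓK`,
`∂K/∂t = 1/(2λ-A)`, `∂K/∂u = (2λ-a)/(2λ-A)`) is the split metric
`JᵀLJ = [[h + (2λ-A)ppᵀ, 0, (2λ-a)p], [0, -1/(2λ-A), 0], [(2λ-a)pᵀ, 0, (2λ-a)²/(2λ-A)]]`. -/
theorem stmt9 (n : ℕ) (h : Matrix (Fin n) (Fin n) ℝ) (hsymm : h.IsSymm)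
    (lam a A : ℝ) (hlam : 0 < lam) (ha0 : 0 ≤ a) (ha1 : a ≤ lam)
    (hA0 : 0 ≤ A) (hA1 : A ≤ lam) (p : Fin n → ℝ)
    (L J : Matrix (Fin n ⊕ Fin 2) (Fin n ⊕ Fin 2) ℝ)
    (hL : L = Matrix.fromBlocks h 0 0 !![-A, 1; 1, 0])
    (hJ : J = Matrix.fromBlocks (1 : Matrix (Fin n) (Fin n) ℝ) 0
      (Matrix.of fun i j => ![(1 : ℝ), lam] i * p j)
      !![1 / (2 * lam - A), (2 * lam - a) / (2 * lam - A);
         -1 + lam / (2 * lam - A), lam * (2 * lam - a) / (2 * lam - A)]) :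
    J.transpose * L * J = Matrix.fromBlocks
      (h + (2 * lam - A) • Matrix.vecMulVec p p)
      (Matrix.of fun i j => ![(0 : ℝ), (2 * lam - a) * p i] j)
      (Matrix.of fun i j => ![(0 : ℝ), (2 * lam - a) * p j] i)
      !![-(1 / (2 * lam - A)), 0; 0, (2 * lam - a) ^ 2 / (2 * lam - A)] := by
  have hne : 2 * lam - A ≠ 0 := by linarith
  obtain ⟨d, rfl⟩ : ∃ d, A = 2 * lam - d := ⟨2 * lam - A, by ring⟩
  rw [sub_sub_cancel] at hne hJ ⊢
  subst hL hJ
  rw [Matrix.fromBlocks_transpose, Matrix.fromBlocks_multiply, Matrix.fromBlocks_multiply,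
    Matrix.fromBlocks_inj]
  refine ⟨?_, ?_, ?_, ?_⟩
  · ext i j
    simp [Matrix.mul_apply, Fin.sum_univ_two, Matrix.vecMulVec_apply]
    ring
  · ext i j
    fin_cases j <;> simp [Matrix.mul_apply, Fin.sum_univ_two] <;> field_simp <;> ring
  · ext i j
    fin_cases i <;> simp [Matrix.mul_apply, Fin.sum_univ_two] <;> field_simp <;> ring
  · ext i j
    fin_cases i <;> fin_cases j <;> simp [Matrix.mul_apply, Fin.sum_univ_two] <;>
      field_simp <;> ring
end

section
/- Let n ∈ ℕ, let h be a symmetric real n×n matrix, let λ > 0, α > 0, d > 0, let a, A ∈ ℝ with 0 ≤ a ≤ λ and 0 ≤ A ≤ λ, and let p ∈ ℝⁿ with Euclidean norm |p| ≤ d. Suppose ṽᵀ h ṽ ≥ α |ṽ|² for all ṽ ∈ ℝⁿ. Define H = [[h + (2λ-A) p pᵀ, (2λ-a) p],[(2λ-a) pᵀ, (2λ-a)²/(2λ-A)]]. Then for every v ∈ ℝ^{n+1}, vᵀ H v ≥ min(α/2, α/(16 d²), λ/16) |v|². -/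
open Matrix

/-- The quadratic form of the block matrix, with the square completed. -/
lemma quadForm_fromBlocks_eq (n : ℕ) (h : Matrix (Fin n) (Fin n) ℝ) (b B : ℝ) (hB : B ≠ 0)
    (p : Fin n → ℝ) (w : Fin n → ℝ) (y : Fin 1 → ℝ) :
    Sum.elim w y ⬝ᵥ (Matrix.fromBlocks (h + B • Matrix.vecMulVec p p)
      (Matrix.of fun i _ => b * p i) (Matrix.of fun _ j => b * p j)
      !![b ^ 2 / B]).mulVec (Sum.elim w y) =
      w ⬝ᵥ h.mulVec w + B * (p ⬝ᵥ w + b / B * y 0) ^ 2 := by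
  have h1 : (Matrix.of fun (i : Fin n) (_ : Fin 1) => b * p i).mulVec y = (b * y 0) • p := by
    ext i
    simp [mulVec, dotProduct]
    ring
  have h2 : (Matrix.of fun (_ : Fin 1) (j : Fin n) => b * p j).mulVec w =
      fun _ => b * (p ⬝ᵥ w) := by
    ext i
    simp [mulVec, dotProduct, Finset.mul_sum, mul_assoc]
  have h3 : (!![b ^ 2 / B] : Matrix (Fin 1) (Fin 1) ℝ).mulVec y = fun _ => b ^ 2 / B * y 0 := by
    ext i
    fin_cases i
    simp [mulVec, dotProduct]
  have h4 : (Matrix.vecMulVec p p).mulVec w = (p ⬝ᵥ w) • p := by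
    ext i
    simp [mulVec, dotProduct, vecMulVec_apply, Finset.sum_mul]
    exact Finset.sum_congr rfl fun j _ => by ring
  have h5 (u : Fin 1 → ℝ) : y ⬝ᵥ u = y 0 * u 0 := by simp [dotProduct]
  rw [fromBlocks_mulVec, sumElim_dotProduct_sumElim]
  simp only [Sum.elim_comp_inl, Sum.elim_comp_inr]
  rw [h1, h2, h3, add_mulVec, smul_mulVec, h4, h5]
  simp only [dotProduct_add, dotProduct_smul, smul_eq_mul, Pi.add_apply, dotProduct_comm w p]
  field_simp
  ring

/-- Cauchy–Schwarz for the dot product. -/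
lemma sq_dotProduct_le {n : ℕ} (p w : Fin n → ℝ) :
    (p ⬝ᵥ w) ^ 2 ≤ (p ⬝ᵥ p) * (w ⬝ᵥ w) := by
  simpa [dotProduct, sq] using Finset.sum_mul_sq_le_sq_mul_sq Finset.univ p w

/-- Uniform lower bound for the slice metric of the NPW splitting: if `h ≥ α·id`,
`|p| ≤ d`, `0 ≤ a, A ≤ λ`, then `vᵀHv ≥ min(α/2, α/(16d²), λ/16)|v|²` for all
`v ∈ ℝⁿ⁺¹`. -/
theorem stmt11 (n : ℕ) (h : Matrix (Fin n) (Fin n) ℝ) (hsymm : h.IsSymm)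
    (lam α d : ℝ) (hlam : 0 < lam) (hα : 0 < α) (hd : 0 < d)
    (a A : ℝ) (ha0 : 0 ≤ a) (ha1 : a ≤ lam) (hA0 : 0 ≤ A) (hA1 : A ≤ lam)
    (p : Fin n → ℝ) (hp : Real.sqrt (p ⬝ᵥ p) ≤ d)
    (hh : ∀ vt : Fin n → ℝ, α * (vt ⬝ᵥ vt) ≤ vt ⬝ᵥ h.mulVec vt)
    (H : Matrix (Fin n ⊕ Fin 1) (Fin n ⊕ Fin 1) ℝ)
    (hH : H = Matrix.fromBlocks
      (h + (2 * lam - A) • Matrix.vecMulVec p p)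
      (Matrix.of fun i _ => (2 * lam - a) * p i)
      (Matrix.of fun _ j => (2 * lam - a) * p j)
      !![(2 * lam - a) ^ 2 / (2 * lam - A)]) :
    ∀ v : Fin n ⊕ Fin 1 → ℝ,
      min (min (α / 2) (α / (16 * d ^ 2))) (lam / 16) * (v ⬝ᵥ v) ≤ v ⬝ᵥ H.mulVec v := by
  intro v
  obtain ⟨w, y, rfl⟩ : ∃ w y, v = Sum.elim w y := ⟨_, _, (Sum.elim_comp_inl_inr v).symm⟩
  have hB : 0 < 2 * lam - A := by linarith
  rw [hH, quadForm_fromBlocks_eq n h _ _ hB.ne', sumElim_dotProduct_sumElim]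
  have hyy : y ⬝ᵥ y = y 0 ^ 2 := by simp [dotProduct, sq]
  have hc : 1 / 2 ≤ (2 * lam - a) / (2 * lam - A) := by
    rw [le_div_iff₀ hB]
    linarith
  set c := (2 * lam - a) / (2 * lam - A)
  set m := min (min (α / 2) (α / (16 * d ^ 2))) (lam / 16)
  have hm0 : 0 < m := by positivity
  have hm1 : m ≤ α / 2 := (min_le_left _ _).trans (min_le_left _ _)
  have hm2 : m * (16 * d ^ 2) ≤ α :=
    (le_div_iff₀ (by positivity)).1 ((min_le_left _ _).trans (min_le_right _ _))
  have hm3 : m ≤ lam / 16 := min_le_right _ _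
  have hpp : p ⬝ᵥ p ≤ d ^ 2 := (Real.sqrt_le_left hd.le).1 hp
  have hw : 0 ≤ w ⬝ᵥ w := by
    simpa [dotProduct] using Finset.sum_nonneg fun i _ => mul_self_nonneg (w i)
  have hs : (p ⬝ᵥ w) ^ 2 ≤ d ^ 2 * (w ⬝ᵥ w) :=
    (sq_dotProduct_le p w).trans (mul_le_mul_of_nonneg_right hpp hw)
  have hhw := hh w
  rw [hyy]
  generalize p ⬝ᵥ w = s at *
  generalize w ⬝ᵥ w = W at *
  generalize y 0 = x at *
  have e1 : m * W ≤ α / 2 * W := mul_le_mul_of_nonneg_right hm1 hw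
  have e2 : 8 * m * s ^ 2 ≤ α / 2 * W := by
    have := mul_le_mul_of_nonneg_left hs hm0.le
    have := mul_le_mul_of_nonneg_right hm2 hw
    linarith
  have e3 : 16 * m * (s + c * x) ^ 2 ≤ (2 * lam - A) * (s + c * x) ^ 2 :=
    mul_le_mul_of_nonneg_right (by linarith) (sq_nonneg _)
  have e4 : x ^ 2 ≤ 8 * s ^ 2 + 16 * (s + c * x) ^ 2 := by
    have hcx : 1 / 4 * x ^ 2 ≤ c ^ 2 * x ^ 2 :=
      mul_le_mul_of_nonneg_right (by nlinarith) (sq_nonneg _)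
    nlinarith [sq_nonneg (3 * s + 2 * (c * x))]
  have e5 := mul_le_mul_of_nonneg_left e4 hm0.le
  linarith
end

section
/- Let n ≥ 1, let h be a positive definite symmetric real n×n matrix, and let λ > 0. For p ∈ ℝⁿ and a, A ∈ [0, λ] let H(p,a,A) = [[h + (2λ-A) p pᵀ, (2λ-a) p],[(2λ-a) pᵀ, (2λ-a)²/(2λ-A)]]. Let (p_k) be a sequence in ℝⁿ with |p_k| → ∞ and let a_k, A_k ∈ [0, λ]. Then there is no constant c > 0 such that vᵀ H(p_k, a_k, A_k) v ≥ c |v|² holds for all k ∈ ℕ and all v ∈ ℝ^{n+1}; i.e., for every c > 0 there exist k and v ≠ 0 with vᵀ H(p_k, a_k, A_k) v < c |v|². -/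
open Matrix

/-- A quadratic form on `ι → ℝ` is bounded by the entrywise `ℓ¹` norm of its matrix times the
squared Euclidean norm. -/
theorem dotProduct_mulVec_le_sum_abs_mul {ι : Type*} [Fintype ι] (M : Matrix ι ι ℝ) (x : ι → ℝ) :
    x ⬝ᵥ M *ᵥ x ≤ (∑ i, ∑ j, |M i j|) * (x ⬝ᵥ x) := by
  have hsq (i : ι) : x i * x i ≤ x ⬝ᵥ x :=
    Finset.single_le_sum (f := fun i => x i * x i) (fun i _ => mul_self_nonneg (x i))
      (Finset.mem_univ i)
  simp only [Finset.sum_mul]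
  have hexp : x ⬝ᵥ M *ᵥ x = ∑ i, ∑ j, x i * (M i j * x j) := by
    simp only [dotProduct, mulVec, Finset.mul_sum]
  rw [hexp]
  refine Finset.sum_le_sum fun i _ => Finset.sum_le_sum fun j _ => ?_
  have hij : |x i * x j| ≤ x ⬝ᵥ x :=
    abs_le.2 ⟨by nlinarith [hsq i, hsq j, sq_nonneg (x i + x j)],
      by nlinarith [hsq i, hsq j, sq_nonneg (x i - x j)]⟩
  calc x i * (M i j * x j) = M i j * (x i * x j) := by ring
    _ ≤ |M i j| * |x i * x j| := by rw [← abs_mul]; exact le_abs_self _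
    _ ≤ _ := by gcongr

/-- If the gradients `p_k` are unbounded, no uniform lower bound of the slice metric
`H(p,a,A)` by a multiple of the Euclidean metric can exist: for every `c > 0` there
are `k` and `v ≠ 0` with `vᵀ H(p_k,a_k,A_k) v < c|v|²`. -/
theorem stmt12 (n : ℕ) (hn : 1 ≤ n) (h : Matrix (Fin n) (Fin n) ℝ) (hpd : h.PosDef)
    (lam : ℝ) (hlam : 0 < lam)
    (H : (Fin n → ℝ) → ℝ → ℝ → Matrix (Fin n ⊕ Fin 1) (Fin n ⊕ Fin 1) ℝ)
    (hH : ∀ (p : Fin n → ℝ) (a A : ℝ), H p a A = Matrix.fromBlocks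
      (h + (2 * lam - A) • Matrix.vecMulVec p p)
      (Matrix.of fun i _ => (2 * lam - a) * p i)
      (Matrix.of fun _ j => (2 * lam - a) * p j)
      !![(2 * lam - a) ^ 2 / (2 * lam - A)])
    (p : ℕ → Fin n → ℝ)
    (hp : Filter.Tendsto (fun k => Real.sqrt (p k ⬝ᵥ p k)) Filter.atTop Filter.atTop)
    (a A : ℕ → ℝ) (ha : ∀ k, a k ∈ Set.Icc 0 lam) (hA : ∀ k, A k ∈ Set.Icc 0 lam) :
    ∀ c : ℝ, 0 < c → ∃ (k : ℕ) (v : Fin n ⊕ Fin 1 → ℝ), v ≠ 0 ∧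
      v ⬝ᵥ (H (p k) (a k) (A k)).mulVec v < c * (v ⬝ᵥ v) := by
  intro c hc
  set C := ∑ i, ∑ j, |h i j|
  have hC : 0 ≤ C := by positivity
  obtain ⟨k, hk⟩ := (hp.eventually_ge_atTop (4 * C / c + 1)).exists
  obtain ⟨ha₀, ha₁⟩ := ha k
  obtain ⟨hA₀, hA₁⟩ := hA k
  have hquad := dotProduct_mulVec_le_sum_abs_mul h (p k)
  set q := p k
  set s := q ⬝ᵥ q with hs
  set α := 2 * lam - a k with hα
  set B := 2 * lam - A k with hB
  have hBlam : lam ≤ B := by linarith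
  have hB₀ : 0 < B := by linarith
  have hone : 1 ≤ √s := le_trans (by linarith [show 0 ≤ 4 * C / c by positivity]) hk
  have hs_ge : 4 * C / c + 1 ≤ s := by
    have hs₀ : 0 ≤ s := by
      by_contra! hneg
      rw [Real.sqrt_eq_zero_of_nonpos hneg.le] at hone
      linarith
    nlinarith [Real.sq_sqrt hs₀]
  have hs₀ : 0 < s := by linarith [show 0 ≤ 4 * C / c by positivity]
  have hCs : 4 * C < c * s := by
    have : 4 * C / c < s := by linarith
    rw [div_lt_iff₀ hc] at this
    linarith
  refine ⟨k, Sum.elim (α • q) (fun _ => -(B * s)), ?_, ?_⟩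
  · intro h0
    have := congrFun h0 (Sum.inr 0)
    simp [hB₀.ne', hs₀.ne'] at this
  · have hcol : (Matrix.of fun (i : Fin n) (_ : Fin 1) => α * q i) *ᵥ (fun _ => -(B * s))
        = -(α * B * s) • q := by
      ext i
      simp [mulVec, dotProduct]
      ring
    have hrow : (Matrix.of fun (_ : Fin 1) (j : Fin n) => α * q j) *ᵥ (α • q)
        = fun _ => α ^ 2 * s := by
      ext i
      simp only [hs, mulVec, dotProduct, of_apply, Pi.smul_apply, smul_eq_mul, Finset.mul_sum]
      exact Finset.sum_congr rfl fun j _ => by ring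
    have hval : Sum.elim (α • q) (fun _ => -(B * s)) ⬝ᵥ
        H q (a k) (A k) *ᵥ Sum.elim (α • q) (fun _ => -(B * s)) = α ^ 2 * (q ⬝ᵥ h *ᵥ q) := by
      rw [hH, fromBlocks_mulVec, sumElim_dotProduct_sumElim]
      simp only [Sum.elim_comp_inl, Sum.elim_comp_inr, ← hα, ← hB, hcol, hrow, add_mulVec,
        smul_mulVec, vecMulVec_mulVec, mulVec_smul, dotProduct_add, dotProduct_smul,
        smul_dotProduct, ← hs, smul_eq_mul, op_smul_eq_smul]
      simp [dotProduct, mulVec]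
      field_simp
      ring
    have hnorm : Sum.elim (α • q) (fun _ : Fin 1 => -(B * s)) ⬝ᵥ
        Sum.elim (α • q) (fun _ => -(B * s)) = α ^ 2 * s + B ^ 2 * s ^ 2 := by
      rw [sumElim_dotProduct_sumElim]
      simp only [dotProduct_smul, smul_dotProduct, ← hs, smul_eq_mul]
      simp [dotProduct]
      ring
    rw [hval, hnorm]
    have hα_sq : α ^ 2 ≤ 4 * lam ^ 2 := by nlinarith
    have hB_sq : lam ^ 2 ≤ B ^ 2 := by gcongr
    calc α ^ 2 * (q ⬝ᵥ h *ᵥ q) ≤ α ^ 2 * (C * s) := by gcongr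
      _ ≤ 4 * lam ^ 2 * (C * s) := by gcongr
      _ = lam ^ 2 * s * (4 * C) := by ring
      _ < lam ^ 2 * s * (c * s) := by gcongr
      _ = c * (lam ^ 2 * s ^ 2) := by ring
      _ ≤ c * (B ^ 2 * s ^ 2) := by gcongr
      _ ≤ c * (α ^ 2 * s + B ^ 2 * s ^ 2) := by
        gcongr
        exact le_add_of_nonneg_left (by positivity)
end

section
/- (Lipschitz implicit function theorem) Let U ⊆ ℝᵐ and V ⊆ ℝⁿ be open, a ∈ U, b ∈ V, and let F : U × V → ℝⁿ be Lipschitz continuous with F(a,b) = 0. Suppose there exist L > 0 and neighborhoods U' ⊆ U of a and V' ⊆ V of b such that |F(x,y₁) - F(x,y₂)| ≥ L |y₁ - y₂| for all x ∈ U' and y₁, y₂ ∈ V'. Then there exist an open neighborhood Ũ ⊆ U of a and a Lipschitz continuous function φ : Ũ → V such that φ(a) = b and F(x, φ(x)) = 0 for all x ∈ Ũ. -/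
open MeasureTheory Metric Set Module
open scoped NNReal ENNReal

lemma LipschitzWith.hausdorffMeasure_image_eq_zero {X Y : Type*} [EMetricSpace X] [EMetricSpace Y]
    [MeasurableSpace X] [BorelSpace X] [MeasurableSpace Y] [BorelSpace Y] {f : X → Y} {K : ℝ≥0}
    (hf : LipschitzWith K f) {d : ℝ} (hd : 0 ≤ d) {s : Set X} (hs : μH[d] s = 0) :
    μH[d] (f '' s) = 0 := by
  have h := hf.hausdorffMeasure_image_le hd s
  rw [hs, mul_zero] at h
  exact le_antisymm h bot_le

section Retraction

variable {E : Type*} [NormedAddCommGroup E] [InnerProductSpace ℝ E] [FiniteDimensional ℝ E]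

/-- The polynomial `t ↦ det (1 + t A)` is recovered from its values at `finrank ℝ E + 1` nodes. -/
lemma det_one_add_smul_eq_sum (A : E →L[ℝ] E) {v : ℕ → ℝ} (hv : Function.Injective v) (t : ℝ) :
    (1 + t • A).det = ∑ i ∈ Finset.range (finrank ℝ E + 1),
      (1 + v i • A).det * (Lagrange.basis (Finset.range (finrank ℝ E + 1)) v i).eval t := by
  let b := Module.finBasis ℝ E
  let M := LinearMap.toMatrix b b (A : E →ₗ[ℝ] E)
  let p : Polynomial ℝ := ((Polynomial.X : Polynomial ℝ) • M.map Polynomial.C +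
    (1 : Matrix _ _ ℝ).map Polynomial.C).det
  have hp : ∀ s : ℝ, p.eval s = (1 + s • A).det := by
    intro s
    have h1 : (1 + s • A).det = (1 + s • M).det := by
      rw [ContinuousLinearMap.det, ← LinearMap.det_toMatrix b]
      congr 1
      ext i j
      simp [M, LinearMap.toMatrix_apply, Matrix.one_apply, Finsupp.single_apply, eq_comm]
    rw [h1]
    simp only [p]
    rw [← Polynomial.coe_evalRingHom, RingHom.map_det]
    congr 1
    ext i j
    by_cases hij : i = j <;> simp [hij, add_comm (1 : ℝ), mul_comm s]
  have hdeg : p.degree < (Finset.range (finrank ℝ E + 1)).card := by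
    have h := Polynomial.natDegree_det_X_add_C_le M (1 : Matrix _ _ ℝ)
    rw [Fintype.card_fin] at h
    rw [Finset.card_range]
    exact (Polynomial.degree_le_of_natDegree_le h).trans_lt (by exact_mod_cast Nat.lt_succ_self _)
  have h := congrArg (Polynomial.eval t) (Lagrange.eq_interpolate (f := p) hv.injOn hdeg)
  rw [hp, Lagrange.interpolate_apply, Polynomial.eval_finsetSum] at h
  simpa [hp] using h

/-- A perturbation of the identity by a contraction is bijective. -/
lemma bijective_add_of_lipschitzWith {h : E → E} {c : ℝ≥0} (hc : c < 1) (hh : LipschitzWith c h) :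
    Function.Bijective fun x ↦ x + h x := by
  constructor
  · intro x y hxy
    have h1 : h x - h y = y - x := by
      have : x + h x = y + h y := hxy
      rw [sub_eq_sub_iff_add_eq_add, add_comm, this, add_comm]
    have h2 := hh.norm_sub_le x y
    rw [h1, norm_sub_rev] at h2
    have hc' : (c : ℝ) < 1 := by exact_mod_cast hc
    by_contra hne
    have : 0 < ‖x - y‖ := norm_pos_iff.2 (sub_ne_zero.2 hne)
    nlinarith
  · intro y
    have hK : ContractingWith c fun x ↦ y - h x := by
      refine ⟨hc, LipschitzWith.of_dist_le_mul fun a b ↦ ?_⟩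
      rw [dist_sub_left]
      exact hh.dist_le_mul a b
    refine ⟨hK.fixedPoint, ?_⟩
    have := hK.fixedPoint_isFixedPt
    have h2 : y - h hK.fixedPoint = hK.fixedPoint := this
    change hK.fixedPoint + h hK.fixedPoint = y
    rw [← eq_sub_iff_add_eq]
    exact h2.symm

variable [MeasurableSpace E] [BorelSpace E]

lemma exists_integral_det_one_add_smul {g : E → E} {K : ℝ≥0} (hg : LipschitzWith K g) {R : ℝ}
    (hsupp : ∀ x, R ≤ ‖x‖ → g x = 0) :
    ∃ ε : ℝ, 0 < ε ∧ ∀ t : ℝ, 0 ≤ t → t ≤ ε →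
      IntegrableOn (fun x ↦ (1 + t • fderiv ℝ g x).det) (ball 0 R) μH[finrank ℝ E] ∧
      ∫ x in ball 0 R, (1 + t • fderiv ℝ g x).det ∂μH[finrank ℝ E] =
        (μH[finrank ℝ E] : Measure E).real (ball 0 R) := by
  let μ : Measure E := μH[finrank ℝ E]
  have hcont := (ContinuousLinearMap.continuous_det (𝕜 := ℝ) (E := E)).continuousAt (x := 1)
  obtain ⟨δ, hδ, hdet⟩ := Metric.continuousAt_iff.1 hcont (1 / 2) (by norm_num)
  have hone : (1 : E →L[ℝ] E).det = 1 := by simp [ContinuousLinearMap.det]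
  have hK0 : (0 : ℝ) ≤ K := K.2
  refine ⟨min δ 1 / (2 * (K + 1)), by positivity, fun t ht0 ht ↦ ?_⟩
  have htK : t * K < min δ 1 := by
    rw [le_div_iff₀ (by positivity)] at ht
    have : 0 < min δ 1 := by positivity
    nlinarith
  have hb : ∀ x, |(1 + t • fderiv ℝ g x).det - 1| < 1 / 2 := by
    intro x
    have h1 : dist (1 + t • fderiv ℝ g x) 1 < δ := by
      rw [dist_eq_norm, add_sub_cancel_left, norm_smul, Real.norm_of_nonneg ht0]
      have := norm_fderiv_le_of_lipschitz ℝ hg (x₀ := x)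
      exact (mul_le_mul_of_nonneg_left this ht0).trans_lt (htK.trans_le (min_le_left _ _))
    have h2 := hdet h1
    rwa [hone, Real.dist_eq] at h2
  have hmeas : Measurable fun x ↦ (1 + t • fderiv ℝ g x).det :=
    ContinuousLinearMap.continuous_det.measurable.comp
      ((measurable_fderiv ℝ g).const_smul t |>.const_add 1)
  have hfin : μ (ball 0 R) < ∞ := measure_ball_lt_top
  refine ⟨Measure.integrableOn_of_bounded (M := 2) hfin.ne hmeas.aestronglyMeasurable
    (Filter.Eventually.of_forall fun x ↦ ?_), ?_⟩
  · have := abs_lt.1 (hb x)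
    rw [Real.norm_eq_abs, abs_le]
    constructor <;> linarith
  set φ : E → E := fun x ↦ x + t • g x with hφ
  have htg : LipschitzWith (Real.toNNReal t * K) fun x ↦ t • g x := by
    refine LipschitzWith.of_dist_le_mul fun x y ↦ ?_
    rw [dist_smul₀, Real.norm_of_nonneg ht0, NNReal.coe_mul, Real.coe_toNNReal _ ht0, mul_assoc]
    exact mul_le_mul_of_nonneg_left (hg.dist_le_mul x y) ht0
  have hbij : Function.Bijective φ := by
    refine bijective_add_of_lipschitzWith ?_ htg
    rw [← NNReal.coe_lt_coe, NNReal.coe_mul, Real.coe_toNNReal _ ht0]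
    exact htK.trans_le (min_le_right _ _)
  have hfix : ∀ x, R ≤ ‖x‖ → φ x = x := fun x hx ↦ by simp [hφ, hsupp x hx]
  have himage : φ '' ball 0 R = ball 0 R := by
    have hcompl : φ '' (ball 0 R)ᶜ = (ball 0 R)ᶜ := by
      ext y
      constructor
      · rintro ⟨x, hx, rfl⟩
        have : R ≤ ‖x‖ := by simpa using hx
        rwa [hfix x this]
      · intro hy
        exact ⟨y, hy, hfix y (by simpa using hy)⟩
    rw [← compl_inj_iff, ← Set.image_compl_eq hbij, hcompl]
  set D : Set E := {x | DifferentiableAt ℝ g x} with hD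
  have hDm : MeasurableSet D := measurableSet_of_differentiableAt ℝ g
  have hDnull : μ Dᶜ = 0 := hg.ae_differentiableAt (μ := μ)
  have hae : (ball 0 R ∩ D : Set E) =ᵐ[μ] ball 0 R :=
    inter_ae_eq_left_of_ae_eq_univ (ae_eq_univ.2 hDnull)
  have hφL : LipschitzWith (1 + Real.toNNReal t * K) φ := LipschitzWith.id.add htg
  have himae : (φ '' (ball 0 R ∩ D)) =ᵐ[μ] ball 0 R := by
    rw [ae_eq_set]
    constructor
    · rw [sdiff_eq_empty.2, measure_empty]
      exact (image_mono inter_subset_left).trans himage.subset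
    · refine measure_mono_null ?_ 
        (hφL.hausdorffMeasure_image_eq_zero (Nat.cast_nonneg _) hDnull)
      rintro y ⟨hy, hyn⟩
      rw [← himage] at hy
      obtain ⟨x, hx, rfl⟩ := hy
      exact ⟨x, fun hxD ↦ hyn ⟨x, ⟨hx, hxD⟩, rfl⟩, rfl⟩
  have hder : ∀ x ∈ ball 0 R ∩ D,
      HasFDerivWithinAt φ (1 + t • fderiv ℝ g x) (ball 0 R ∩ D) x := fun x hx ↦
    ((hasFDerivAt_id x).add (hx.2.hasFDerivAt.const_smul t)).hasFDerivWithinAt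
  have hcv := integral_image_eq_integral_abs_det_fderiv_smul μ (measurableSet_ball.inter hDm)
    hder hbij.1.injOn (fun _ ↦ (1 : ℝ))
  rw [setIntegral_congr_set himae, setIntegral_congr_set hae] at hcv
  have habs : ∀ x, |(1 + t • fderiv ℝ g x).det| • (1 : ℝ) = (1 + t • fderiv ℝ g x).det := by
    intro x
    have := abs_lt.1 (hb x)
    rw [smul_eq_mul, mul_one, abs_of_pos (by linarith)]
  simp_rw [habs] at hcv
  rw [← hcv]
  simp [μ]

/-- There is no Lipschitz retraction of a closed ball onto its boundary sphere. -/
theorem not_lipschitz_retraction {g : E → E} {K : ℝ≥0} (hg : LipschitzWith K g) {R : ℝ}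
    (hR : 0 < R) (hsupp : ∀ x, R ≤ ‖x‖ → g x = 0) (hsphere : ∀ x ∈ ball 0 R, ‖x + g x‖ = R) :
    False := by
  let μ : Measure E := μH[finrank ℝ E]
  obtain ⟨ε, hε, h⟩ := exists_integral_det_one_add_smul hg hsupp
  let v : ℕ → ℝ := fun i ↦ ε / (i + 1)
  have hv : Function.Injective v := by
    intro i j hij
    have hi : (0 : ℝ) < i + 1 := by positivity
    have hj : (0 : ℝ) < j + 1 := by positivity
    simp only [v] at hij
    rw [div_eq_div_iff hi.ne' hj.ne'] at hij
    have := mul_left_cancel₀ hε.ne' hij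
    have : (j : ℝ) = i := by linarith
    exact_mod_cast this.symm
  have hv0 : ∀ i, 0 ≤ v i := fun i ↦ by positivity
  have hvε : ∀ i, v i ≤ ε := fun i ↦ div_le_self hε.le (by simp)
  have hzero : ∀ᵐ x ∂(μ.restrict (ball 0 R)), (1 + (1 : ℝ) • fderiv ℝ g x).det = 0 := by
    rw [ae_restrict_iff' measurableSet_ball]
    filter_upwards [hg.ae_differentiableAt (μ := μ)] with x hx hxR
    by_contra hne
    have hd : HasFDerivAt (fun x ↦ x + g x) (1 + (1 : ℝ) • fderiv ℝ g x) x := by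
      rw [one_smul]
      exact (hasFDerivAt_id x).add hx.hasFDerivAt
    have hsq := hd.norm_sq
    have hconst : (fun y ↦ ‖y + g y‖ ^ 2) =ᶠ[nhds x] fun _ ↦ R ^ 2 := by
      filter_upwards [isOpen_ball.mem_nhds hxR] with y hy
      rw [hsphere y hy]
    have hz := hsq.unique ((hasFDerivAt_const (R ^ 2) x).congr_of_eventuallyEq hconst)
    have hu : IsUnit (LinearMap.det ((1 + (1 : ℝ) • fderiv ℝ g x : E →L[ℝ] E) : E →ₗ[ℝ] E)) :=
      isUnit_iff_ne_zero.2 hne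
    obtain ⟨w, hw⟩ := (LinearMap.equivOfDetNeZero _ hu.ne_zero).surjective (x + g x)
    have hw' : (1 + (1 : ℝ) • fderiv ℝ g x) w = x + g x := hw
    have := congrArg (fun T : E →L[ℝ] ℝ ↦ T w) hz
    simp only [smul_apply, ContinuousLinearMap.comp_apply,
      zero_apply, innerSL_apply_apply] at this
    rw [hw', real_inner_self_eq_norm_sq, hsphere x hxR] at this
    simp at this
    exact hR.ne' this
  have h0 : ∫ x in ball 0 R, (1 + (1 : ℝ) • fderiv ℝ g x).det ∂μ = 0 :=
    integral_eq_zero_of_ae hzero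
  rw [integral_congr_ae (.of_forall fun x ↦ det_one_add_smul_eq_sum (fderiv ℝ g x) hv 1)] at h0
  rw [integral_finsetSum _ fun i _ ↦ ((h (v i) (hv0 i) (hvε i)).1.mul_const _)] at h0
  simp only [integral_mul_const, fun i ↦ (h (v i) (hv0 i) (hvε i)).2] at h0
  rw [← Finset.mul_sum, ← Polynomial.eval_finsetSum, Lagrange.sum_basis hv.injOn (by simp),
    Polynomial.eval_one, mul_one] at h0
  have hpos : 0 < (μH[finrank ℝ E] : Measure E).real (ball 0 R) :=
    ENNReal.toReal_pos (measure_ball_pos _ _ hR).ne' measure_ball_lt_top.ne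
  exact hpos.ne' h0

end Retraction

section LipschitzAux

variable {X E : Type*} [PseudoMetricSpace X] [NormedAddCommGroup E] [NormedSpace ℝ E]

lemma LipschitzOnWith.exists_smul {a : X → ℝ} {u : X → E} {s : Set X} {Ka Ku : ℝ≥0}
    (ha : LipschitzOnWith Ka a s) (hu : LipschitzOnWith Ku u s) {A B : ℝ}
    (hA : ∀ x ∈ s, |a x| ≤ A) (hB : ∀ x ∈ s, ‖u x‖ ≤ B) :
    ∃ K : ℝ≥0, LipschitzOnWith K (fun x ↦ a x • u x) s := by
  refine ⟨A.toNNReal * Ku + Ka * B.toNNReal, LipschitzOnWith.of_dist_le_mul fun x hx y hy ↦ ?_⟩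
  have hA0 : 0 ≤ A := (abs_nonneg _).trans (hA x hx)
  have hB0 : 0 ≤ B := (norm_nonneg _).trans (hB x hx)
  have h1 := ha.dist_le_mul x hx y hy
  have h2 := hu.dist_le_mul x hx y hy
  rw [dist_eq_norm] at h1 h2
  have heq : a x • u x - a y • u y = a x • (u x - u y) + (a x - a y) • u y := by module
  push_cast
  rw [Real.coe_toNNReal _ hA0, Real.coe_toNNReal _ hB0, dist_eq_norm, heq]
  calc _ ≤ |a x| * ‖u x - u y‖ + ‖a x - a y‖ * ‖u y‖ := by
        simpa only [norm_smul, Real.norm_eq_abs] using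
          norm_add_le (a x • (u x - u y)) ((a x - a y) • u y)
    _ ≤ A * (Ku * dist x y) + Ka * dist x y * B :=
        add_le_add (mul_le_mul (hA x hx) h2 (norm_nonneg _) hA0)
          (mul_le_mul h1 (hB y hy) (norm_nonneg _) (by positivity))
    _ = _ := by ring

lemma LipschitzOnWith.exists_normalize {u : X → E} {s : Set X} {K : ℝ≥0}
    (hu : LipschitzOnWith K u s) {η : ℝ} (hη : 0 < η) (hs : ∀ x ∈ s, η ≤ ‖u x‖) :
    ∃ K' : ℝ≥0, LipschitzOnWith K' (fun x ↦ ‖u x‖⁻¹ • u x) s := by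
  refine ⟨2 * K / η.toNNReal, LipschitzOnWith.of_dist_le_mul fun x hx y hy ↦ ?_⟩
  have hx0 : 0 < ‖u x‖ := hη.trans_le (hs x hx)
  have hy0 : 0 < ‖u y‖ := hη.trans_le (hs y hy)
  have h1 := hu.dist_le_mul x hx y hy
  rw [dist_eq_norm] at h1
  push_cast
  rw [Real.coe_toNNReal _ hη.le, dist_eq_norm]
  have heq : ‖u x‖⁻¹ • u x - ‖u y‖⁻¹ • u y =
      ‖u x‖⁻¹ • ((u x - u y) + ((‖u y‖ - ‖u x‖) * ‖u y‖⁻¹) • u y) := by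
    have : ‖u x‖⁻¹ * ((‖u y‖ - ‖u x‖) * ‖u y‖⁻¹) = ‖u x‖⁻¹ - ‖u y‖⁻¹ := by field_simp
    rw [smul_add, smul_smul, this]
    module
  rw [heq, norm_smul, norm_inv, norm_norm]
  have h2 : ‖((‖u y‖ - ‖u x‖) * ‖u y‖⁻¹) • u y‖ ≤ ‖u x - u y‖ := by
    rw [norm_smul, norm_mul, norm_inv, norm_norm, mul_assoc, inv_mul_cancel₀ hy0.ne', mul_one,
      Real.norm_eq_abs, norm_sub_rev (u x)]
    exact abs_norm_sub_norm_le _ _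
  have h3 := norm_add_le (u x - u y) (((‖u y‖ - ‖u x‖) * ‖u y‖⁻¹) • u y)
  calc _ ≤ η⁻¹ * (2 * (K * dist x y)) := by
        refine mul_le_mul (inv_anti₀ hη (hs x hx)) (by linarith) (norm_nonneg _) (by positivity)
    _ = _ := by ring

/-- Extending a Lipschitz map on a closed ball that vanishes on the boundary sphere by zero. -/
lemma LipschitzOnWith.lipschitzWith_indicator {g : E → E} {K : ℝ≥0} {R : ℝ}
    (hg : LipschitzOnWith K g (closedBall 0 R)) (h0 : ∀ x ∈ sphere 0 R, g x = 0) :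
    LipschitzWith K ((closedBall 0 R).indicator g) := by
  have key : ∀ x ∈ closedBall (0 : E) R, ∀ y ∉ closedBall (0 : E) R, ‖g x‖ ≤ K * dist x y := by
    intro x hx y hy
    have hcont : ContinuousOn (fun t : ℝ ↦ ‖AffineMap.lineMap x y t‖) (Icc 0 1) := by
      fun_prop
    have hmem : R ∈ Icc ‖AffineMap.lineMap x y (0 : ℝ)‖ ‖AffineMap.lineMap x y (1 : ℝ)‖ := by
      simp only [AffineMap.lineMap_apply_zero, AffineMap.lineMap_apply_one]
      simp only [mem_closedBall, dist_zero_right, not_le] at hx hy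
      exact ⟨hx, hy.le⟩
    obtain ⟨t, ht, htR⟩ := intermediate_value_Icc zero_le_one hcont hmem
    have hz : AffineMap.lineMap x y t ∈ sphere (0 : E) R := by simpa using htR
    have h1 := hg.dist_le_mul x hx _ (sphere_subset_closedBall hz)
    rw [h0 _ hz, dist_zero_right, dist_left_lineMap, Real.norm_of_nonneg ht.1] at h1
    exact h1.trans (mul_le_mul_of_nonneg_left (mul_le_of_le_one_left dist_nonneg ht.2) K.2)
  refine LipschitzWith.of_dist_le_mul fun x y ↦ ?_
  by_cases hx : x ∈ closedBall (0 : E) R <;> by_cases hy : y ∈ closedBall (0 : E) R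
  · simpa [indicator_of_mem hx, indicator_of_mem hy] using hg.dist_le_mul x hx y hy
  · simpa [indicator_of_mem hx, indicator_of_notMem hy] using key x hx y hy
  · rw [indicator_of_notMem hx, indicator_of_mem hy, dist_zero_left, dist_comm]
    exact key y hy x hx
  · rw [indicator_of_notMem hx, indicator_of_notMem hy, dist_self]
    positivity

/-- Pushing points away from `c`: a Lipschitz map close to the identity that maps the complement
of a small ball around `c` outside of `ball c ε`. -/
lemma exists_push_away {s : Set E} {c : E} {η ε : ℝ} (hη : 0 < η) (hε : 0 < ε)
    (hs : ∀ y ∈ s, η ≤ ‖y - c‖) :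
    ∃ (Φ : E → E) (K : ℝ≥0), LipschitzOnWith K Φ s ∧ (∀ y ∈ s, ‖Φ y - y‖ ≤ ε) ∧
      (∀ y ∈ s, ε ≤ ‖y - c‖ → Φ y = y) ∧ ∀ y ∈ s, ‖y - c‖ ≤ ε → Φ y ∈ sphere c ε := by
  have hsub : LipschitzOnWith 1 (fun y ↦ y - c) s :=
    LipschitzOnWith.of_dist_le_mul fun x _ y _ ↦ by simp
  have hnorm : LipschitzOnWith 1 (fun y ↦ max 0 (ε - ‖y - c‖)) s := by
    refine (LipschitzWith.const_max (LipschitzWith.of_dist_le_mul fun x y ↦ ?_) 0).lipschitzOnWith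
    rw [Real.dist_eq, sub_sub_sub_cancel_left, NNReal.coe_one, one_mul, dist_comm, dist_eq_norm]
    simpa using abs_norm_sub_norm_le (y - c) (x - c)
  obtain ⟨K₁, hK₁⟩ := hsub.exists_normalize hη hs
  have hunit : ∀ y ∈ s, ‖‖y - c‖⁻¹ • (y - c)‖ = 1 := fun y hy ↦ by
    rw [norm_smul, norm_inv, norm_norm, inv_mul_cancel₀ (hη.trans_le (hs y hy)).ne']
  have hbd : ∀ y, |max 0 (ε - ‖y - c‖)| ≤ ε := fun y ↦ by
    rw [abs_of_nonneg (le_max_left _ _)]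
    exact max_le hε.le (sub_le_self _ (norm_nonneg _))
  obtain ⟨K₂, hK₂⟩ := hnorm.exists_smul hK₁ (A := ε) (B := 1) (fun y _ ↦ hbd y)
    fun y hy ↦ (hunit y hy).le
  refine ⟨_, _, LipschitzWith.id.lipschitzOnWith.add hK₂, fun y hy ↦ ?_, fun y hy h ↦ ?_,
    fun y hy h ↦ ?_⟩
  · simp only [id, add_sub_cancel_left]
    rw [norm_smul, hunit y hy, mul_one]
    exact hbd y
  · simp [max_eq_left (sub_nonpos.2 h)]
  · have hy0 := hη.trans_le (hs y hy)
    rw [mem_sphere_iff_norm, id, max_eq_right (sub_nonneg.2 h)]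
    have heq : y + (ε - ‖y - c‖) • ‖y - c‖⁻¹ • (y - c) - c = ε • ‖y - c‖⁻¹ • (y - c) := by
      rw [sub_smul, smul_inv_smul₀ hy0.ne']
      abel
    rw [heq, norm_smul, hunit y hy, mul_one, Real.norm_of_nonneg hε.le]

end LipschitzAux

section Openness

variable {E : Type*} [NormedAddCommGroup E] [InnerProductSpace ℝ E] [FiniteDimensional ℝ E]

/-- A Lipschitz map on a ball that is close to the identity has a zero. -/
theorem exists_zero_of_lipschitzOnWith_of_close {H : E → E} {K : ℝ≥0} {R : ℝ} (hR : 0 < R)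
    (hH : LipschitzOnWith K H (closedBall 0 R)) (hclose : ∀ x ∈ closedBall 0 R, ‖H x - x‖ ≤ R / 4) :
    ∃ x ∈ closedBall 0 R, H x = 0 := by
  borelize E
  by_contra! hne
  let χ : E → ℝ := fun x ↦ min 1 (2 - 2 / R * ‖x‖)
  have hχL : LipschitzWith (Real.toNNReal (2 / R)) χ := by
    refine LipschitzWith.const_min (LipschitzWith.of_dist_le_mul fun x y ↦ ?_) 1
    rw [Real.coe_toNNReal _ (by positivity), Real.dist_eq, dist_eq_norm, sub_sub_sub_cancel_left,
      ← mul_sub, abs_mul, abs_of_pos (by positivity : 0 < 2 / R), norm_sub_rev]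
    exact mul_le_mul_of_nonneg_left (abs_norm_sub_norm_le _ _) (by positivity)
  have hχ0 : ∀ x ∈ closedBall (0 : E) R, 0 ≤ χ x := by
    intro x hx
    rw [mem_closedBall_zero_iff] at hx
    refine le_min zero_le_one ?_
    have : 2 / R * ‖x‖ ≤ 2 / R * R := mul_le_mul_of_nonneg_left hx (by positivity)
    rw [div_mul_cancel₀ _ hR.ne'] at this
    linarith
  have hχ1 : ∀ x, χ x ≤ 1 := fun x ↦ min_le_left _ _
  obtain ⟨K₁, hK₁⟩ := (hχL.lipschitzOnWith (s := closedBall 0 R)).exists_smul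
    (hH.sub (LipschitzWith.id.lipschitzOnWith)) (A := 1) (B := R / 4)
    (fun x hx ↦ abs_le.2 ⟨by linarith [hχ0 x hx], hχ1 x⟩) hclose
  let P : E → E := fun x ↦ x + χ x • (H x - x)
  have hPL : LipschitzOnWith (1 + K₁) P (closedBall 0 R) :=
    LipschitzWith.id.lipschitzOnWith.add hK₁
  have hPne : ∀ x ∈ closedBall 0 R, P x ≠ 0 := by
    intro x hx h0
    rcases le_or_gt ‖x‖ (R / 2) with hxR | hxR
    · have : χ x = 1 := by
        refine min_eq_left ?_
        have : 2 / R * ‖x‖ ≤ 2 / R * (R / 2) := mul_le_mul_of_nonneg_left hxR (by positivity)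
        have h2 : 2 / R * (R / 2) = 1 := by field_simp
        linarith
      apply hne x hx
      simpa [P, this] using h0
    · have h1 : x = -(χ x • (H x - x)) := eq_neg_of_add_eq_zero_left h0
      have h2 : ‖x‖ ≤ R / 4 := by
        rw [h1, norm_neg, norm_smul, Real.norm_of_nonneg (hχ0 x hx)]
        exact (mul_le_of_le_one_left (norm_nonneg _) (hχ1 x)).trans (hclose x hx)
      linarith
  have hPb : ∀ x ∈ sphere (0 : E) R, P x = x := by
    intro x hx
    rw [mem_sphere_zero_iff_norm] at hx
    have : χ x = 0 := by
      simp only [χ, hx, div_mul_cancel₀ _ hR.ne']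
      norm_num
    simp [P, this]
  obtain ⟨x₀, hx₀, hmin⟩ := (isCompact_closedBall (0 : E) R).exists_isMinOn
    (nonempty_closedBall.2 hR.le) hPL.continuousOn.norm
  obtain ⟨K₂, hK₂⟩ := hPL.exists_normalize (norm_pos_iff.2 (hPne x₀ hx₀)) fun x hx ↦ hmin hx
  obtain ⟨K₃, hK₃⟩ := (LipschitzWith.const R).lipschitzOnWith (s := closedBall (0 : E) R)
    |>.exists_smul hK₂ (A := R) (B := 1) (fun x _ ↦ (abs_of_pos hR).le) fun x _ ↦ by
      rw [norm_smul, norm_inv, norm_norm]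
      exact inv_mul_le_one
  have hgL := hK₃.sub (LipschitzWith.id.lipschitzOnWith)
  have hg := hgL.lipschitzWith_indicator fun x hx ↦ by
    rw [hPb x hx, mem_sphere_zero_iff_norm.1 hx, smul_inv_smul₀ hR.ne', id, sub_self]
  refine not_lipschitz_retraction hg hR (fun x hx ↦ ?_) fun x hx ↦ ?_
  · by_cases hxR : x ∈ closedBall (0 : E) R
    · rw [indicator_of_mem hxR]
      have hxs : ‖x‖ = R := le_antisymm (mem_closedBall_zero_iff.1 hxR) hx
      rw [hPb x (mem_sphere_zero_iff_norm.2 hxs), hxs, smul_inv_smul₀ hR.ne', id, sub_self]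
    · exact indicator_of_notMem hxR _
  · have hxR := ball_subset_closedBall hx
    rw [indicator_of_mem hxR, id, add_sub_cancel, norm_smul, norm_smul, norm_inv, norm_norm,
      inv_mul_cancel₀ (norm_ne_zero_iff.2 (hPne x hxR)), mul_one, Real.norm_of_nonneg hR.le]

/-- Invariance of domain for bi-Lipschitz maps. -/
theorem image_closedBall_mem_nhds_of_bilipschitz {f : E → E} {K : ℝ≥0} {L R : ℝ} (hL : 0 < L)
    (hR : 0 < R) {b : E} (hf : LipschitzOnWith K f (closedBall b R))
    (hlow : ∀ x ∈ closedBall b R, ∀ y ∈ closedBall b R, L * ‖x - y‖ ≤ ‖f x - f y‖) :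
    f '' closedBall b R ∈ nhds (f b) := by
  borelize E
  let μ : Measure E := μH[finrank ℝ E]
  set B := closedBall b R with hB
  have hbB : b ∈ B := mem_closedBall_self hR.le
  have hinj : InjOn f B := fun x hx y hy hxy ↦ by
    have := hlow x hx y hy
    rw [hxy, sub_self, norm_zero] at this
    exact sub_eq_zero.1 (norm_le_zero_iff.1 (by nlinarith [norm_nonneg (x - y)]))
  have hinv : LipschitzOnWith (Real.toNNReal L⁻¹) (Function.invFunOn f B) (f '' B) := by
    refine LipschitzOnWith.of_dist_le_mul ?_
    rintro _ ⟨x, hx, rfl⟩ _ ⟨y, hy, rfl⟩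
    rw [hinj.leftInvOn_invFunOn hx, hinj.leftInvOn_invFunOn hy,
      Real.coe_toNNReal _ (by positivity), dist_eq_norm, dist_eq_norm, ← div_eq_inv_mul,
      le_div_iff₀' hL]
    exact hlow x hx y hy
  obtain ⟨G, hG, hGf⟩ := hinv.extend_finite_dimension
  set M : ℝ≥0 := lipschitzExtensionConstant E * Real.toNNReal L⁻¹ with hM
  have hGf' : ∀ x ∈ B, G (f x) = x := fun x hx ↦ by
    rw [← hGf ⟨x, hx, rfl⟩, hinj.leftInvOn_invFunOn hx]
  have hM0 : (0 : ℝ) ≤ M := M.2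
  set ε : ℝ := R / (8 * (M + 1)) with hεd
  have hε : 0 < ε := by positivity
  have hMε : M * ε ≤ R / 8 := by
    have : (8 * (M + 1)) * ε = R := mul_div_cancel₀ _ (by positivity)
    nlinarith
  by_contra hnot
  have hnhds : ¬ ball (f b) ε ⊆ f '' B := fun h ↦
    hnot (Filter.mem_of_superset (ball_mem_nhds _ hε) h)
  obtain ⟨c, hcε, hc⟩ := not_subset.1 hnhds
  rw [mem_ball, dist_comm, dist_eq_norm] at hcε
  have hcomp : IsCompact (f '' B) := (isCompact_closedBall b R).image_of_continuousOn hf.continuousOn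
  obtain ⟨η, hη, hdist⟩ : ∃ η > 0, ∀ y ∈ f '' B, η ≤ ‖y - c‖ := by
    obtain ⟨η, hη, h⟩ := Metric.isOpen_iff.1 hcomp.isClosed.isOpen_compl c hc
    refine ⟨η, hη, fun y hy ↦ ?_⟩
    by_contra! hlt
    exact h (mem_ball_iff_norm.2 hlt) hy
  obtain ⟨Φ, KΦ, hΦ, hΦε, hΦid, hΦs⟩ := exists_push_away hη hε hdist
  set δ : ℝ := min ((ε - ‖f b - c‖) / (K + 1)) (R / 8) with hδd
  have hδ : 0 < δ := lt_min (div_pos (sub_pos.2 hcε) (by positivity)) (by positivity)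
  have hfar : ∀ x ∈ B, ε ≤ ‖f x - c‖ → δ ≤ ‖x - b‖ := by
    intro x hx hxc
    have h1 := hf.dist_le_mul x hx b hbB
    rw [dist_eq_norm, dist_eq_norm] at h1
    have h2 := norm_add_le (f x - f b) (f b - c)
    rw [sub_add_sub_cancel] at h2
    refine (min_le_left _ _).trans ?_
    rw [div_le_iff₀ (by positivity)]
    nlinarith [norm_nonneg (x - b)]
  have hnull : μ (G '' sphere c ε) = 0 :=
    hG.hausdorffMeasure_image_eq_zero (Nat.cast_nonneg _)
      (Measure.addHaar_sphere_of_ne_zero μ c hε.ne')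
  obtain ⟨w, hwb, hw⟩ : ∃ w ∈ ball b δ, w ∉ G '' sphere c ε := by
    by_contra! h
    exact (measure_ball_pos μ b hδ).ne' (measure_mono_null h hnull)
  rw [mem_ball_iff_norm] at hwb
  let H : E → E := fun x ↦ G (Φ (f (x + b))) - w
  have hmem : ∀ x ∈ closedBall (0 : E) R, x + b ∈ B := fun x hx ↦ by
    simpa [hB, dist_eq_norm] using hx
  have hHL : LipschitzOnWith (M * (KΦ * (K * 1))) H (closedBall 0 R) := by
    have h1 : LipschitzOnWith 1 (fun x : E ↦ x + b) (closedBall 0 R) :=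
      LipschitzOnWith.of_dist_le_mul fun x _ y _ ↦ by simp
    have h2 := hG.comp_lipschitzOnWith (hΦ.comp (hf.comp h1 hmem)
      fun x hx ↦ mem_image_of_mem f (hmem x hx))
    refine LipschitzOnWith.of_dist_le_mul fun x hx y hy ↦ ?_
    simpa only [H, dist_sub_right, Function.comp_apply] using h2.dist_le_mul x hx y hy
  have hclose : ∀ x ∈ closedBall 0 R, ‖H x - x‖ ≤ R / 4 := by
    intro x hx
    have hxB := hmem x hx
    have h1 := hG.norm_sub_le (Φ (f (x + b))) (f (x + b))
    rw [hGf' _ hxB] at h1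
    have h2 := mul_le_mul_of_nonneg_left (hΦε _ (mem_image_of_mem f hxB)) hM0
    have heq : H x - x = (G (Φ (f (x + b))) - (x + b)) - (w - b) := by
      simp only [H]
      abel
    rw [heq]
    have h3 := norm_sub_le (G (Φ (f (x + b))) - (x + b)) (w - b)
    have h4 : δ ≤ R / 8 := min_le_right _ _
    linarith
  obtain ⟨x, hx, hx0⟩ := exists_zero_of_lipschitzOnWith_of_close hR hHL hclose
  have hxB := hmem x hx
  have hGw : G (Φ (f (x + b))) = w := sub_eq_zero.1 hx0
  rcases le_total ε ‖f (x + b) - c‖ with h | h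
  · rw [hΦid _ (mem_image_of_mem f hxB) h, hGf' _ hxB] at hGw
    have := hfar _ hxB h
    rw [hGw] at this
    linarith
  · exact hw ⟨_, hΦs _ (mem_image_of_mem f hxB) h, hGw⟩

/-- Quantitative openness of bi-Lipschitz maps. -/
theorem ball_subset_image_closedBall_of_bilipschitz {f : E → E} {K : ℝ≥0} {L R : ℝ} (hL : 0 < L)
    (hR : 0 < R) {b : E} (hf : LipschitzOnWith K f (closedBall b R))
    (hlow : ∀ x ∈ closedBall b R, ∀ y ∈ closedBall b R, L * ‖x - y‖ ≤ ‖f x - f y‖) :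
    ball (f b) (L * R / 2) ⊆ f '' closedBall b R := by
  intro z hz
  have hbB : b ∈ closedBall b R := mem_closedBall_self hR.le
  obtain ⟨y, hy, hmin⟩ := (isCompact_closedBall b R).exists_isMinOn ⟨b, hbB⟩
    (hf.continuousOn.sub continuousOn_const).norm (f := fun y ↦ ‖f y - z‖)
  have hmin' : ∀ x ∈ closedBall b R, ‖f y - z‖ ≤ ‖f x - z‖ := fun x hx ↦ hmin hx
  refine ⟨y, hy, ?_⟩
  by_contra hne
  rw [mem_ball, dist_comm, dist_eq_norm] at hz
  have hyb : ‖y - b‖ < R := by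
    have h1 := hlow y hy b hbB
    have h2 := norm_sub_le (f y - z) (f b - z)
    rw [sub_sub_sub_cancel_right] at h2
    have h3 := hmin' b hbB
    have : L * ‖y - b‖ < L * R := by linarith
    exact lt_of_mul_lt_mul_left this hL.le
  have hsub : closedBall y (R - ‖y - b‖) ⊆ closedBall b R :=
    closedBall_subset_closedBall' (by rw [dist_eq_norm]; linarith)
  have hnhds := image_closedBall_mem_nhds_of_bilipschitz hL (sub_pos.2 hyb) (hf.mono hsub)
    fun x hx x' hx' ↦ hlow x (hsub hx) x' (hsub hx')
  have htend : Filter.Tendsto (fun t : ℝ ↦ AffineMap.lineMap (f y) z t) (nhdsWithin 0 (Ioi 0))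
      (nhds (f y)) := by
    have : Continuous fun t : ℝ ↦ AffineMap.lineMap (f y) z t := by fun_prop
    simpa using (this.tendsto 0).mono_left nhdsWithin_le_nhds
  have hev := htend.eventually hnhds
  obtain ⟨t, ⟨x, hx, hxt⟩, ht0, ht1⟩ := (hev.and (Ioo_mem_nhdsGT (zero_lt_one' ℝ))).exists
  have h := hmin' x (hsub hx)
  rw [hxt, ← dist_eq_norm, ← dist_eq_norm, dist_lineMap_right,
    Real.norm_of_nonneg (by linarith)] at h
  have : 0 < dist (f y) z := dist_pos.2 hne
  nlinarith

end Openness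

/-- Implicit function theorem for Lipschitz functions: if `F : U × V → ℝⁿ` is
Lipschitz, `F(a,b) = 0`, and `|F(x,y₁) - F(x,y₂)| ≥ L|y₁ - y₂|` near `(a,b)`, then
there is an open neighborhood `Ũ` of `a` and a Lipschitz map `φ : Ũ → V` with
`φ(a) = b` and `F(x, φ(x)) = 0` on `Ũ`. -/
theorem stmt13 (m n : ℕ)
    (U : Set (EuclideanSpace ℝ (Fin m))) (V : Set (EuclideanSpace ℝ (Fin n)))
    (hU : IsOpen U) (hV : IsOpen V)
    (a : EuclideanSpace ℝ (Fin m)) (b : EuclideanSpace ℝ (Fin n))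
    (ha : a ∈ U) (hb : b ∈ V)
    (F : EuclideanSpace ℝ (Fin m) × EuclideanSpace ℝ (Fin n) → EuclideanSpace ℝ (Fin n))
    (κ : NNReal) (hFLip : LipschitzOnWith κ F (U ×ˢ V))
    (hF0 : F (a, b) = 0) (L : ℝ) (hL : 0 < L)
    (U' : Set (EuclideanSpace ℝ (Fin m))) (V' : Set (EuclideanSpace ℝ (Fin n)))
    (hU'o : IsOpen U') (hV'o : IsOpen V') (hU'U : U' ⊆ U) (hV'V : V' ⊆ V)
    (haU' : a ∈ U') (hbV' : b ∈ V')
    (hlow : ∀ x ∈ U', ∀ y₁ ∈ V', ∀ y₂ ∈ V',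
      L * ‖y₁ - y₂‖ ≤ ‖F (x, y₁) - F (x, y₂)‖) :
    ∃ (Ut : Set (EuclideanSpace ℝ (Fin m)))
      (φ : EuclideanSpace ℝ (Fin m) → EuclideanSpace ℝ (Fin n)) (κ' : NNReal),
      IsOpen Ut ∧ a ∈ Ut ∧ Ut ⊆ U ∧ LipschitzOnWith κ' φ Ut ∧ φ a = b ∧
      ∀ x ∈ Ut, φ x ∈ V ∧ F (x, φ x) = 0 := by
  obtain ⟨r, hr, hrV⟩ := Metric.nhds_basis_closedBall.mem_iff.1 (hV'o.mem_nhds hbV')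
  obtain ⟨ρ₀, hρ₀, hρU⟩ := Metric.isOpen_iff.1 hU'o a haU'
  have hκ0 : (0 : ℝ) ≤ κ := κ.2
  set ρ : ℝ := min ρ₀ (L * r / (2 * (κ + 1))) with hρd
  have hρ : 0 < ρ := lt_min hρ₀ (by positivity)
  have hUt : ball a ρ ⊆ U' := (ball_subset_ball (min_le_left _ _)).trans hρU
  have hsol : ∀ x ∈ ball a ρ, ∃ y ∈ closedBall b r, F (x, y) = 0 := by
    intro x hx
    have hxU := hUt hx
    have hlip : LipschitzOnWith κ (fun y ↦ F (x, y)) (closedBall b r) := by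
      refine LipschitzOnWith.of_dist_le_mul fun y hy y' hy' ↦ ?_
      have := hFLip.dist_le_mul (x, y) ⟨hU'U hxU, hV'V (hrV hy)⟩ (x, y') ⟨hU'U hxU, hV'V (hrV hy')⟩
      rwa [dist_prod_same_left] at this
    have hsub := ball_subset_image_closedBall_of_bilipschitz hL hr hlip
      fun y hy y' hy' ↦ hlow x hxU y (hrV hy) y' (hrV hy')
    have h1 := hFLip.dist_le_mul (a, b) ⟨ha, hb⟩ (x, b) ⟨hU'U hxU, hb⟩
    rw [hF0, dist_prod_same_right, dist_comm a x] at h1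
    have h2 : dist x a < L * r / (2 * (κ + 1)) := (mem_ball.1 hx).trans_le (min_le_right _ _)
    rw [lt_div_iff₀ (by positivity)] at h2
    have h3 : (0 : EuclideanSpace ℝ (Fin n)) ∈ ball (F (x, b)) (L * r / 2) := by
      rw [mem_ball]
      nlinarith [dist_nonneg (x := x) (y := a)]
    exact hsub h3
  choose! φ hφB hφ0 using hsol
  have haB : a ∈ ball a ρ := mem_ball_self hρ
  refine ⟨ball a ρ, φ, Real.toNNReal (κ / L), isOpen_ball, haB, hUt.trans hU'U, ?_, ?_,
    fun x hx ↦ ⟨hV'V (hrV (hφB x hx)), hφ0 x hx⟩⟩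
  · refine LipschitzOnWith.of_dist_le_mul fun x hx x' hx' ↦ ?_
    have h1 := hlow x (hUt hx) _ (hrV (hφB x hx)) _ (hrV (hφB x' hx'))
    have h2 := hFLip.dist_le_mul (x, φ x') ⟨hU'U (hUt hx), hV'V (hrV (hφB x' hx'))⟩
      (x', φ x') ⟨hU'U (hUt hx'), hV'V (hrV (hφB x' hx'))⟩
    rw [hφ0 x' hx', dist_prod_same_right, dist_zero_right] at h2
    rw [hφ0 x hx, zero_sub, norm_neg] at h1
    rw [Real.coe_toNNReal _ (by positivity), dist_eq_norm, div_mul_eq_mul_div, le_div_iff₀' hL]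
    exact h1.trans h2
  · have h1 := hlow a haU' _ (hrV (hφB a haB)) b hbV'
    rw [hφ0 a haB, hF0, sub_self, norm_zero] at h1
    exact sub_eq_zero.1 (norm_le_zero_iff.1 (by nlinarith [norm_nonneg (φ a - b)]))
end

section
/- Let λ > 0, let a_ε : ℝ → ℝ (ε ∈ (0,1]) be continuous and a₀ : ℝ → ℝ be measurable, all with values in [0, λ], and suppose ∫_{-m}^{m} |a_ε(s) - a₀(s)| ds → 0 as ε → 0 for every m > 0. Define F_ε(u) = ∫₀ᵘ(2λ - a_ε(s))ds, K_ε(t,u) = F_ε⁻¹(t + F_ε(u)), Φ_ε(t,u) = (K_ε(t,u), -t + λ K_ε(t,u)), and analogously F₀, K₀, Φ₀ from a₀. Then for every compact set L ⊆ ℝ² and every 0 < α < 1, Φ_ε → Φ₀ in the Hölder space C^{0,α}(L, ℝ²), i.e., sup_{p ∈ L} |Φ_ε(p) - Φ₀(p)| + sup_{p ≠ q ∈ L} |(Φ_ε - Φ₀)(p) - (Φ_ε - Φ₀)(q)| / |p - q|^α → 0 as ε → 0. -/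
open Filter

theorem intervalIntegrable_of_mem_Icc {lam : ℝ} {a : ℝ → ℝ} (ha : Measurable a)
    (hbd : ∀ s, a s ∈ Set.Icc 0 lam) (x y : ℝ) :
    IntervalIntegrable a MeasureTheory.volume x y := by
  refine (intervalIntegrable_const (c := lam)).mono_fun ha.aestronglyMeasurable
    (Eventually.of_forall fun s => ?_)
  change ‖a s‖ ≤ ‖lam‖
  rw [Real.norm_of_nonneg (hbd s).1]
  exact (hbd s).2.trans (le_abs_self lam)

/-- The primitive of `2λ - a` vanishing at the origin. -/
noncomputable def profilePrimitive (lam : ℝ) (a : ℝ → ℝ) (u : ℝ) : ℝ :=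
  ∫ s in (0 : ℝ)..u, (2 * lam - a s)

/-- The first component of the splitting map built from the profile `a`. -/
noncomputable def splittingTime (lam : ℝ) (a : ℝ → ℝ) (t u : ℝ) : ℝ :=
  Function.invFun (profilePrimitive lam a) (t + profilePrimitive lam a u)

section Profile

variable {lam : ℝ} {a b : ℝ → ℝ}

theorem profilePrimitive_sub (ha : Measurable a) (hbd : ∀ s, a s ∈ Set.Icc 0 lam) (x y : ℝ) :
    profilePrimitive lam a x - profilePrimitive lam a y = ∫ s in y..x, (2 * lam - a s) :=
  intervalIntegral.integral_interval_sub_left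
    (intervalIntegrable_const.sub (intervalIntegrable_of_mem_Icc ha hbd _ _))
    (intervalIntegrable_const.sub (intervalIntegrable_of_mem_Icc ha hbd _ _))

theorem le_profilePrimitive_sub (ha : Measurable a) (hbd : ∀ s, a s ∈ Set.Icc 0 lam)
    {x y : ℝ} (hyx : y ≤ x) :
    lam * (x - y) ≤ profilePrimitive lam a x - profilePrimitive lam a y := by
  rw [profilePrimitive_sub ha hbd]
  have h := intervalIntegral.integral_mono_on hyx (intervalIntegrable_const (c := lam))
    (intervalIntegrable_const.sub (intervalIntegrable_of_mem_Icc ha hbd _ _))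
    (fun s _ => show lam ≤ 2 * lam - a s by linarith [(hbd s).2])
  simpa [mul_comm] using h

theorem profilePrimitive_sub_le (ha : Measurable a) (hbd : ∀ s, a s ∈ Set.Icc 0 lam)
    {x y : ℝ} (hyx : y ≤ x) :
    profilePrimitive lam a x - profilePrimitive lam a y ≤ 2 * lam * (x - y) := by
  rw [profilePrimitive_sub ha hbd]
  have h := intervalIntegral.integral_mono_on hyx
    (intervalIntegrable_const.sub (intervalIntegrable_of_mem_Icc ha hbd _ _))
    (intervalIntegrable_const (c := 2 * lam))
    (fun s _ => show 2 * lam - a s ≤ 2 * lam by linarith [(hbd s).1])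
  rwa [intervalIntegral.integral_const, smul_eq_mul, mul_comm (x - y)] at h

theorem mul_abs_le_abs_profilePrimitive_sub (ha : Measurable a)
    (hbd : ∀ s, a s ∈ Set.Icc 0 lam) (x y : ℝ) :
    lam * |x - y| ≤ |profilePrimitive lam a x - profilePrimitive lam a y| := by
  rcases le_total y x with h | h
  · rw [abs_of_nonneg (sub_nonneg.2 h)]
    exact (le_profilePrimitive_sub ha hbd h).trans (le_abs_self _)
  · rw [abs_sub_comm x y, abs_of_nonneg (sub_nonneg.2 h), abs_sub_comm]
    exact (le_profilePrimitive_sub ha hbd h).trans (le_abs_self _)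

theorem abs_profilePrimitive_sub_le (hlam : 0 < lam) (ha : Measurable a)
    (hbd : ∀ s, a s ∈ Set.Icc 0 lam) (x y : ℝ) :
    |profilePrimitive lam a x - profilePrimitive lam a y| ≤ 2 * lam * |x - y| := by
  wlog h : y ≤ x generalizing x y
  · rw [abs_sub_comm, abs_sub_comm x y]
    exact this y x (le_of_not_ge h)
  have h1 := le_profilePrimitive_sub ha hbd h
  have h2 := mul_nonneg hlam.le (sub_nonneg.2 h)
  rw [abs_of_nonneg (sub_nonneg.2 h), abs_of_nonneg (h2.trans h1)]
  exact profilePrimitive_sub_le ha hbd h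

theorem profilePrimitive_surjective (hlam : 0 < lam) (ha : Measurable a)
    (hbd : ∀ s, a s ∈ Set.Icc 0 lam) : Function.Surjective (profilePrimitive lam a) := by
  have hcont : Continuous (profilePrimitive lam a) :=
    intervalIntegral.continuous_primitive
      (fun x y => intervalIntegrable_const.sub (intervalIntegrable_of_mem_Icc ha hbd x y)) 0
  have h0 : profilePrimitive lam a 0 = 0 := intervalIntegral.integral_same
  refine hcont.surjective ?_ ?_
  · refine tendsto_atTop_mono' _ ?_ (tendsto_id.const_mul_atTop hlam)
    filter_upwards [eventually_ge_atTop 0] with x hx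
    simpa [h0] using le_profilePrimitive_sub ha hbd hx
  · refine tendsto_atBot_mono' _ ?_ (tendsto_id.const_mul_atBot hlam)
    filter_upwards [eventually_le_atBot 0] with x hx
    have := le_profilePrimitive_sub ha hbd hx
    rw [h0] at this
    simp only [id]
    linarith

theorem profilePrimitive_splittingTime (hlam : 0 < lam) (ha : Measurable a)
    (hbd : ∀ s, a s ∈ Set.Icc 0 lam) (t u : ℝ) :
    profilePrimitive lam a (splittingTime lam a t u) = t + profilePrimitive lam a u :=
  Function.invFun_eq (profilePrimitive_surjective hlam ha hbd _)

theorem mul_abs_splittingTime_sub_self_le (hlam : 0 < lam) (ha : Measurable a)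
    (hbd : ∀ s, a s ∈ Set.Icc 0 lam) (t u : ℝ) :
    lam * |splittingTime lam a t u - u| ≤ |t| := by
  have h := mul_abs_le_abs_profilePrimitive_sub ha hbd (splittingTime lam a t u) u
  rwa [profilePrimitive_splittingTime hlam ha hbd, add_sub_cancel_right] at h

theorem mul_abs_splittingTime_sub_le (hlam : 0 < lam) (ha : Measurable a)
    (hbd : ∀ s, a s ∈ Set.Icc 0 lam) (t u t' u' : ℝ) :
    lam * |splittingTime lam a t u - splittingTime lam a t' u'| ≤
      |t - t'| + 2 * lam * |u - u'| := by
  have h := mul_abs_le_abs_profilePrimitive_sub ha hbd (splittingTime lam a t u)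
    (splittingTime lam a t' u')
  rw [profilePrimitive_splittingTime hlam ha hbd, profilePrimitive_splittingTime hlam ha hbd,
    add_sub_add_comm] at h
  exact h.trans ((abs_add_le _ _).trans
    (by gcongr; exact abs_profilePrimitive_sub_le hlam ha hbd u u'))

theorem abs_profilePrimitive_sub_profilePrimitive_le (ha : Measurable a)
    (hbd : ∀ s, a s ∈ Set.Icc 0 lam) (hb : Measurable b) (hbb : ∀ s, b s ∈ Set.Icc 0 lam)
    {m x : ℝ} (hx : |x| ≤ m) :
    |profilePrimitive lam a x - profilePrimitive lam b x| ≤ ∫ s in (-m)..m, |a s - b s| := by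
  have hm : -m ≤ m := by linarith [abs_nonneg x]
  have hia := intervalIntegrable_of_mem_Icc ha hbd
  have hib := intervalIntegrable_of_mem_Icc hb hbb
  have hint := ((hia (-m) m).sub (hib (-m) m)).abs
  have hxm := abs_le.1 hx
  unfold profilePrimitive
  rw [← intervalIntegral.integral_sub (intervalIntegrable_const.sub (hia 0 x))
    (intervalIntegrable_const.sub (hib 0 x)), ← Real.norm_eq_abs]
  refine (intervalIntegral.norm_integral_le_integral_norm_uIoc).trans ?_
  rw [intervalIntegral.integral_of_le hm]
  have hsub : Set.uIoc 0 x ⊆ Set.Ioc (-m) m := by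
    rw [Set.uIoc]
    refine Set.Ioc_subset_Ioc (le_min (by linarith [abs_nonneg x]) hxm.1)
      (max_le (by linarith [abs_nonneg x]) hxm.2)
  have heq : ∀ s, ‖2 * lam - a s - (2 * lam - b s)‖ = |a s - b s| := fun s => by
    rw [Real.norm_eq_abs, sub_sub_sub_cancel_left, abs_sub_comm]
  simp only [heq]
  exact MeasureTheory.setIntegral_mono_set ((intervalIntegrable_iff_integrableOn_Ioc_of_le hm).1 hint)
    (Eventually.of_forall fun s => abs_nonneg _) hsub.eventuallyLE

theorem mul_abs_splittingTime_sub_splittingTime_le (hlam : 0 < lam) (ha : Measurable a)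
    (hbd : ∀ s, a s ∈ Set.Icc 0 lam) (hb : Measurable b) (hbb : ∀ s, b s ∈ Set.Icc 0 lam)
    {R t u : ℝ} (ht : |t| ≤ R) (hu : |u| ≤ R) :
    lam * |splittingTime lam a t u - splittingTime lam b t u| ≤
      2 * ∫ s in (-(R + R / lam))..(R + R / lam), |a s - b s| := by
  set x := splittingTime lam a t u
  have hR : 0 ≤ R := (abs_nonneg t).trans ht
  have hxu : |x - u| ≤ R / lam := by
    rw [le_div_iff₀' hlam]
    exact (mul_abs_splittingTime_sub_self_le hlam ha hbd t u).trans ht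
  have hx : |x| ≤ R + R / lam := by
    have := abs_add_le u (x - u)
    rw [add_sub_cancel] at this
    linarith
  have hu' : |u| ≤ R + R / lam := hu.trans (le_add_of_nonneg_right (by positivity))
  have h1 := abs_profilePrimitive_sub_profilePrimitive_le ha hbd hb hbb hx
  have h2 := abs_profilePrimitive_sub_profilePrimitive_le ha hbd hb hbb hu'
  have h := mul_abs_le_abs_profilePrimitive_sub hb hbb x (splittingTime lam b t u)
  have e : profilePrimitive lam b x - profilePrimitive lam b (splittingTime lam b t u) =
      (profilePrimitive lam a u - profilePrimitive lam b u) -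
        (profilePrimitive lam a x - profilePrimitive lam b x) := by
    rw [profilePrimitive_splittingTime hlam ha hbd, profilePrimitive_splittingTime hlam hb hbb]
    ring
  rw [e] at h
  linarith [abs_sub (profilePrimitive lam a u - profilePrimitive lam b u)
    (profilePrimitive lam a x - profilePrimitive lam b x)]

end Profile

theorem Real.le_rpow_mul_rpow_of_le {d A B α : ℝ} (hd : 0 ≤ d) (hA : d ≤ A) (hB : d ≤ B)
    (h0 : 0 ≤ α) (h1 : α ≤ 1) : d ≤ A ^ (1 - α) * B ^ α := by
  calc d = d ^ (1 - α) * d ^ α := by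
        rw [← Real.rpow_add_of_nonneg hd (sub_nonneg.2 h1) h0, sub_add_cancel, Real.rpow_one]
    _ ≤ A ^ (1 - α) * B ^ α :=
        mul_le_mul (Real.rpow_le_rpow hd hA (sub_nonneg.2 h1)) (Real.rpow_le_rpow hd hB h0)
          (Real.rpow_nonneg hd _) (Real.rpow_nonneg (hd.trans hA) _)


/-- In the two-dimensional case, `L¹_loc` convergence `a_ε → a₀` of the profiles implies
convergence `Φ_ε → Φ₀` of the splitting maps `Φ(t,u) = (K(t,u), -t + λK(t,u))` in the
Hölder space `C^{0,α}(L, ℝ²)` for every compact `L ⊆ ℝ²` and every `0 < α < 1`. -/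
theorem stmt18 (lam : ℝ) (hlam : 0 < lam)
    (aeps : ℝ → ℝ → ℝ) (a₀ : ℝ → ℝ)
    (haepscont : ∀ ε ∈ Set.Ioc (0 : ℝ) 1, Continuous (aeps ε))
    (haepsbd : ∀ ε ∈ Set.Ioc (0 : ℝ) 1, ∀ s, aeps ε s ∈ Set.Icc 0 lam)
    (ha₀meas : Measurable a₀) (ha₀bd : ∀ s, a₀ s ∈ Set.Icc 0 lam)
    (hconv : ∀ m : ℝ, 0 < m →
      Filter.Tendsto (fun ε => ∫ s in (-m : ℝ)..m, |aeps ε s - a₀ s|)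
        (nhdsWithin 0 (Set.Ioc 0 1)) (nhds 0))
    (Feps : ℝ → ℝ → ℝ) (F₀ : ℝ → ℝ)
    (hFeps : ∀ ε u, Feps ε u = ∫ s in (0 : ℝ)..u, (2 * lam - aeps ε s))
    (hF₀ : ∀ u, F₀ u = ∫ s in (0 : ℝ)..u, (2 * lam - a₀ s))
    (Keps : ℝ → ℝ → ℝ → ℝ) (K₀ : ℝ → ℝ → ℝ)
    (hKeps : ∀ ε t u, Keps ε t u = Function.invFun (Feps ε) (t + Feps ε u))
    (hK₀ : ∀ t u, K₀ t u = Function.invFun F₀ (t + F₀ u))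
    (Φeps : ℝ → ℝ × ℝ → ℝ × ℝ) (Φ₀ : ℝ × ℝ → ℝ × ℝ)
    (hΦeps : ∀ ε p, Φeps ε p = (Keps ε p.1 p.2, -p.1 + lam * Keps ε p.1 p.2))
    (hΦ₀ : ∀ p, Φ₀ p = (K₀ p.1 p.2, -p.1 + lam * K₀ p.1 p.2)) :
    ∀ L : Set (ℝ × ℝ), IsCompact L → ∀ α : ℝ, 0 < α → α < 1 →
      Filter.Tendsto
        (fun ε => (⨆ p ∈ L, ‖Φeps ε p - Φ₀ p‖) +
          ⨆ (p : ℝ × ℝ) (_ : p ∈ L) (q : ℝ × ℝ) (_ : q ∈ L) (_ : p ≠ q),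
            ‖(Φeps ε p - Φ₀ p) - (Φeps ε q - Φ₀ q)‖ / ‖p - q‖ ^ α)
        (nhdsWithin 0 (Set.Ioc 0 1)) (nhds 0) := by
  intro L hL α hα0 hα1
  obtain ⟨R, hRpos, hR⟩ := hL.isBounded.exists_pos_norm_le
  set m := R + R / lam with hm
  have hmpos : 0 < m := by positivity
  have hI := hconv m hmpos
  set I : ℝ → ℝ := fun ε => ∫ s in (-m : ℝ)..m, |aeps ε s - a₀ s|
  have hI0 : ∀ ε, 0 ≤ I ε := fun ε =>
    intervalIntegral.integral_nonneg (by linarith) fun s _ => abs_nonneg _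
  obtain rfl : Feps = fun ε => profilePrimitive lam (aeps ε) :=
    funext fun ε => funext fun u => hFeps ε u
  obtain rfl : F₀ = profilePrimitive lam a₀ := funext hF₀
  obtain rfl : Keps = fun ε => splittingTime lam (aeps ε) :=
    funext fun ε => funext fun t => funext fun u => hKeps ε t u
  obtain rfl : K₀ = splittingTime lam a₀ := funext fun t => funext fun u => hK₀ t u
  set D : ℝ → ℝ × ℝ → ℝ := fun ε p =>
    splittingTime lam (aeps ε) p.1 p.2 - splittingTime lam a₀ p.1 p.2 with hD
  have hΦ : ∀ ε p, Φeps ε p - Φ₀ p = (D ε p, lam * D ε p) := fun ε p => by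
    rw [hΦeps, hΦ₀, hD]
    ext <;> simp
    ring
  have hnorm : ∀ d : ℝ, ‖((d, lam * d) : ℝ × ℝ)‖ ≤ (1 + lam) * |d| := fun d => by
    rw [Prod.norm_def, Real.norm_eq_abs, Real.norm_eq_abs, abs_mul, abs_of_pos hlam]
    have := mul_nonneg hlam.le (abs_nonneg d)
    exact max_le (by linarith) (by linarith [abs_nonneg d])
  set C : ℝ := (1 + 2 * lam) / lam with hC
  have hCpos : 0 < C := by positivity
  have hDsup : ∀ ε ∈ Set.Ioc (0 : ℝ) 1, ∀ p ∈ L, |D ε p| ≤ 2 * I ε / lam := by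
    intro ε hε p hp
    rw [le_div_iff₀' hlam]
    exact mul_abs_splittingTime_sub_splittingTime_le hlam (haepscont ε hε).measurable
      (haepsbd ε hε) ha₀meas ha₀bd ((norm_fst_le p).trans (hR p hp))
      ((norm_snd_le p).trans (hR p hp))
  have hLip : ∀ a : ℝ → ℝ, Measurable a → (∀ s, a s ∈ Set.Icc 0 lam) → ∀ p q : ℝ × ℝ,
      |splittingTime lam a p.1 p.2 - splittingTime lam a q.1 q.2| ≤ C * ‖p - q‖ := by
    intro a ha hbd p q
    rw [hC, div_mul_eq_mul_div, le_div_iff₀' hlam]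
    have h1 : |p.1 - q.1| ≤ ‖p - q‖ := norm_fst_le (p - q)
    have h2 : |p.2 - q.2| ≤ ‖p - q‖ := norm_snd_le (p - q)
    have h3 := mul_abs_splittingTime_sub_le hlam ha hbd p.1 p.2 q.1 q.2
    nlinarith
  have hDhol : ∀ ε ∈ Set.Ioc (0 : ℝ) 1, ∀ p ∈ L, ∀ q ∈ L, |D ε p - D ε q| ≤
      (4 * I ε / lam) ^ (1 - α) * ((2 * C) ^ α * ‖p - q‖ ^ α) := by
    intro ε hε p hp q hq
    rw [← Real.mul_rpow (by positivity) (norm_nonneg _)]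
    refine Real.le_rpow_mul_rpow_of_le (abs_nonneg _) ?_ ?_ hα0.le hα1.le
    · have h1 := hDsup ε hε p hp
      have h2 := hDsup ε hε q hq
      calc |D ε p - D ε q| ≤ |D ε p| + |D ε q| := abs_sub _ _
        _ ≤ 2 * I ε / lam + 2 * I ε / lam := add_le_add h1 h2
        _ = 4 * I ε / lam := by ring
    · have h1 := hLip (aeps ε) (haepscont ε hε).measurable (haepsbd ε hε) p q
      have h2 := hLip a₀ ha₀meas ha₀bd p q
      have h3 := abs_sub
        (splittingTime lam (aeps ε) p.1 p.2 - splittingTime lam (aeps ε) q.1 q.2)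
        (splittingTime lam a₀ p.1 p.2 - splittingTime lam a₀ q.1 q.2)
      rw [sub_sub_sub_comm] at h3
      simp only [hD]
      linarith
  have hlim : Tendsto (fun ε => (1 + lam) * (2 * I ε / lam) +
      (1 + lam) * ((4 * I ε / lam) ^ (1 - α) * (2 * C) ^ α))
      (nhdsWithin 0 (Set.Ioc 0 1)) (nhds 0) := by
    have h1 : Tendsto (fun ε => 2 * I ε / lam) (nhdsWithin 0 (Set.Ioc 0 1)) (nhds 0) := by
      simpa using (hI.const_mul 2).div_const lam
    have h2 : Tendsto (fun ε => 4 * I ε / lam) (nhdsWithin 0 (Set.Ioc 0 1)) (nhds 0) := by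
      simpa using (hI.const_mul 4).div_const lam
    have h3 := h2.rpow_const (p := 1 - α) (Or.inr (by linarith))
    rw [Real.zero_rpow (by linarith)] at h3
    simpa using (h1.const_mul (1 + lam)).add ((h3.mul_const ((2 * C) ^ α)).const_mul (1 + lam))
  refine squeeze_zero' (Eventually.of_forall fun ε => ?_) ?_ hlim
  · refine add_nonneg (Real.iSup_nonneg fun p => Real.iSup_nonneg fun _ => norm_nonneg _)
      (Real.iSup_nonneg fun p => Real.iSup_nonneg fun _ => Real.iSup_nonneg fun q =>
        Real.iSup_nonneg fun _ => Real.iSup_nonneg fun _ => by positivity)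
  · filter_upwards [self_mem_nhdsWithin] with ε hε
    have hIε := hI0 ε
    have hb1 : 0 ≤ (1 + lam) * (2 * I ε / lam) := by positivity
    have hb2 : 0 ≤ (1 + lam) * ((4 * I ε / lam) ^ (1 - α) * (2 * C) ^ α) := by positivity
    refine add_le_add
      (Real.iSup_le (fun p => Real.iSup_le (fun hp => ?_) hb1) hb1)
      (Real.iSup_le (fun p => Real.iSup_le (fun hp => Real.iSup_le (fun q =>
        Real.iSup_le (fun hq => Real.iSup_le (fun hpq => ?_) hb2) hb2) hb2) hb2) hb2)
    · rw [hΦ]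
      refine (hnorm _).trans ?_
      gcongr
      exact hDsup ε hε p hp
    · rw [hΦ, hΦ, Prod.mk_sub_mk, ← mul_sub,
        div_le_iff₀ (Real.rpow_pos_of_pos (norm_pos_iff.2 (sub_ne_zero.2 hpq)) _),
        mul_assoc, mul_assoc]
      refine (hnorm _).trans ?_
      gcongr
      exact hDhol ε hε p hp q hq
end
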